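/- Let c>0, let 1≤κ≤2 and μ>0. Then there exists a constant C>0, depending only on κ, μ and c, such that the following holds: if φ,ψ:ℝ³→ℝ are smooth and u* is a smooth solution of ∂_t²u*−c²Δ_x u*=0 on (0,∞)×ℝ³ with u*(0,·)=φ and ∂_t u*(0,·)=ψ, then for every t>0 and every x∈ℝ³ with x≠0, ⟨|x|⟩·⟨t+|x|⟩·⟨ct−|x|⟩^{κ−1}·|D_{+,c}u*(t,x)| ≤ C·B_{κ+μ+1,2}[φ,ψ;c](t,x). -/

import Mathlib

noncomputable section

namespace PaperKatayama

/-- Euclidean 3-space. -/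
abbrev E3 := EuclideanSpace ℝ (Fin 3)

/-- Space-time functions. -/
abbrev Fn := ℝ → E3 → ℝ

/-- Functions of the space variable alone. -/
abbrev SFn := E3 → ℝ

/-- The Japanese bracket `⟨a⟩ = √(1+a²)`. -/
def jb (a : ℝ) : ℝ := Real.sqrt (1 + a ^ 2)

/-- Time derivative `∂_t`. -/
def pt (f : Fn) : Fn := fun t x => deriv (fun s => f s x) t

/-- Spatial derivative `∂_j` (j = 1,2,3, here indexed by `Fin 3`). -/
def pd (j : Fin 3) (f : Fn) : Fn :=
  fun t x => fderiv ℝ (f t) x (EuclideanSpace.single j 1)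

/-- `∂_a` for `a ∈ {0,1,2,3}`, with `∂_0 = ∂_t`. -/
def pda (a : Fin 4) : Fn → Fn := Fin.cases pt (fun j => pd j) a

/-- Rotation field `Ω_{jk} = x_j ∂_k − x_k ∂_j`, extended antisymmetrically
(so `rotA k j = − rotA j k`, and `rotA j j = 0`). -/
def rotA (j k : Fin 3) (f : Fn) : Fn :=
  fun t x => x j * pd k f t x - x k * pd j f t x

/-- Radial derivative `∂_r = Σ_j (x_j/r) ∂_j`. -/
def pr (f : Fn) : Fn := fun t x => ∑ j, (x j / ‖x‖) * pd j f t x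

/-- `D_{+,c} = ∂_t + c ∂_r`. -/
def Dp (c : ℝ) (f : Fn) : Fn := fun t x => pt f t x + c * pr f t x

/-- `D_{−,c} = ∂_t − c ∂_r`. -/
def Dm (c : ℝ) (f : Fn) : Fn := fun t x => pt f t x - c * pr f t x

/-- The seven fields `Z = {∂_t, ∂_1, ∂_2, ∂_3, Ω_{12}, Ω_{13}, Ω_{23}}`. -/
def Zop : Fin 7 → Fn → Fn :=
  ![pt, pd 0, pd 1, pd 2, rotA 0 1, rotA 0 2, rotA 1 2]

/-- `Z^α = Z_1^{α_1} ⋯ Z_7^{α_7}`. -/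
def Zpow (α : Fin 7 → ℕ) (f : Fn) : Fn :=
  (Zop 0)^[α 0] <| (Zop 1)^[α 1] <| (Zop 2)^[α 2] <| (Zop 3)^[α 3] <|
    (Zop 4)^[α 4] <| (Zop 5)^[α 5] <| (Zop 6)^[α 6] f

/-- Multi-indices `α` (for the seven fields) with `|α| ≤ s`. -/
def multiIdx (s : ℕ) : Finset (Fin 7 → ℕ) :=
  (Fintype.piFinset fun _ => Finset.range (s + 1)).filter fun α => ∑ i, α i ≤ s

/-- `|v(t,x)|_s = Σ_{|α| ≤ s} |Z^α v(t,x)|`. -/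
def vnorm (s : ℕ) (f : Fn) (t : ℝ) (x : E3) : ℝ :=
  ∑ α ∈ multiIdx s, |Zpow α f t x|

/-- Smoothness of a space-time function. -/
def Smooth (f : Fn) : Prop := ContDiff ℝ (⊤ : ℕ∞) (fun p : ℝ × E3 => f p.1 p.2)

/-- `u` is a smooth solution of `∂_t²u − c²Δu = G` on `(0,∞)×ℝ³`
with zero initial data. -/
def IsWaveSol (c : ℝ) (G u : Fn) : Prop :=
  Smooth u ∧
    (∀ t x, 0 < t → pt (pt u) t x - c ^ 2 * ∑ j, pd j (pd j u) t x = G t x) ∧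
    (∀ x, u 0 x = 0) ∧ (∀ x, pt u 0 x = 0)

/-- `u` is a smooth solution of the free wave equation `∂_t²u − c²Δu = 0`
on `(0,∞)×ℝ³` with initial data `φ, ψ`. -/
def IsFreeWaveSol (c : ℝ) (φ ψ : SFn) (u : Fn) : Prop :=
  Smooth u ∧
    (∀ t x, 0 < t → pt (pt u) t x - c ^ 2 * ∑ j, pd j (pd j u) t x = 0) ∧
    (∀ x, u 0 x = φ x) ∧ (∀ x, pt u 0 x = ψ x)

/-- Extension of the speeds `c_1, …, c_N` by `c_0 = 0`. -/
def cs0 {N : ℕ} (cs : Fin N → ℝ) : Fin (N + 1) → ℝ := Fin.cases 0 cs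

/-- The weight `w(t,r) = min_{0 ≤ j ≤ N} ⟨c_j t − r⟩` (with `c_0 = 0`). -/
def wgt {N : ℕ} (cs : Fin N → ℝ) (t r : ℝ) : ℝ :=
  Finset.univ.inf' Finset.univ_nonempty fun j : Fin (N + 1) => jb (cs0 cs j * t - r)

/-- The weighted sup `A_{ρ,μ,s}[G;c](t,x)` over the backward cone `Λ_c(t,x)`. -/
def Afun (ρ μ : ℝ) (s : ℕ) (G : Fn) (c : ℝ) {N : ℕ} (cs : Fin N → ℝ)
    (t : ℝ) (x : E3) : ℝ :=
  sSup {a : ℝ | ∃ τ : ℝ, ∃ y : E3, 0 ≤ τ ∧ τ ≤ t ∧ ‖y - x‖ ≤ c * (t - τ) ∧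
    a = ‖y‖ * jb (τ + ‖y‖) ^ ρ * wgt cs τ ‖y‖ ^ (1 + μ) * vnorm s G τ y}

/-- Spatial derivative of a function of `x` alone. -/
def sd (j : Fin 3) (φ : SFn) : SFn :=
  fun x => fderiv ℝ φ x (EuclideanSpace.single j 1)

/-- Spatial rotation field for functions of `x` alone. -/
def srot (j k : Fin 3) (φ : SFn) : SFn :=
  fun x => x j * sd k φ x - x k * sd j φ x

/-- The six spatial fields `{∂_1, ∂_2, ∂_3, Ω_{12}, Ω_{13}, Ω_{23}}`. -/
def Sop : Fin 6 → SFn → SFn :=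
  ![sd 0, sd 1, sd 2, srot 0 1, srot 0 2, srot 1 2]

/-- `Z^α` for the spatial fields. -/
def Spow (α : Fin 6 → ℕ) (φ : SFn) : SFn :=
  (Sop 0)^[α 0] <| (Sop 1)^[α 1] <| (Sop 2)^[α 2] <| (Sop 3)^[α 3] <|
    (Sop 4)^[α 4] <| (Sop 5)^[α 5] φ

/-- Spatial multi-indices with `|α| ≤ s`. -/
def smultiIdx (s : ℕ) : Finset (Fin 6 → ℕ) :=
  (Fintype.piFinset fun _ => Finset.range (s + 1)).filter fun α => ∑ i, α i ≤ s

/-- `|φ(x)|_s` for a function of `x` alone. -/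
def snorm (s : ℕ) (φ : SFn) (x : E3) : ℝ :=
  ∑ α ∈ smultiIdx s, |Spow α φ x|

/-- The weighted sup `B_{ρ,s}[φ,ψ;c](t,x)`. -/
def Bfun (ρ : ℝ) (s : ℕ) (φ ψ : SFn) (c t : ℝ) (x : E3) : ℝ :=
  sSup {b : ℝ | ∃ y : E3, ‖y - x‖ ≤ c * t ∧
    b = jb ‖y‖ ^ ρ * (snorm (s + 1) φ y + snorm s ψ y)}

/-- `Φ_ρ(t,r)`. -/
def Phi (ρ t r : ℝ) : ℝ :=
  if ρ = 0 then Real.log (2 + jb (t + r) / jb (t - r)) else jb (t - r) ^ (-ρ)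

/-- `Ψ_ρ(t)`. -/
def Psi (ρ t : ℝ) : ℝ := if ρ = 0 then Real.log (2 + t) else 1

/-- The null form `Q_0(v,w;c) = (∂_t v)(∂_t w) − c²(∇v)·(∇w)`. -/
def Q0f (c : ℝ) (v w : Fn) : Fn :=
  fun t x => pt v t x * pt w t x - c ^ 2 * ∑ j, pd j v t x * pd j w t x

/-- The null form `Q_{ab}(v,w) = (∂_a v)(∂_b w) − (∂_b v)(∂_a w)`. -/
def Qab (a b : Fin 4) (v w : Fn) : Fn :=
  fun t x => pda a v t x * pda b w t x - pda b v t x * pda a w t x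

/-- Lorentz boost `L_{c,j} = (x_j/c)∂_t + c t ∂_j`. -/
def Lb (c : ℝ) (j : Fin 3) (f : Fn) : Fn :=
  fun t x => (x j / c) * pt f t x + c * t * pd j f t x

/-- Scaling field `S = t ∂_t + x·∇_x`. -/
def Sc (f : Fn) : Fn := fun t x => t * pt f t x + ∑ j, x j * pd j f t x

/-- `v(t,r,ω) = r u(t, rω)`. -/
def Vrad (u : Fn) (ω : E3) (t r : ℝ) : ℝ := r * u t (r • ω)

/-- `(∂_t + ∂_r) v` in the variables `(t,r)` for fixed `ω`. -/
def DpV (u : Fn) (ω : E3) (t r : ℝ) : ℝ :=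
  deriv (fun s => Vrad u ω s r) t + deriv (fun ρ' => Vrad u ω t ρ') r

/-- Cross product in ℝ³. -/
def cross3 (a b : Fin 3 → ℝ) : Fin 3 → ℝ :=
  ![a 1 * b 2 - a 2 * b 1, a 2 * b 0 - a 0 * b 2, a 0 * b 1 - a 1 * b 0]

/-- `Ωv = (Ω_{23}v, −Ω_{13}v, Ω_{12}v)`. -/
def OmegaVec (v : Fn) (t : ℝ) (x : E3) : Fin 3 → ℝ :=
  ![rotA 1 2 v t x, -(rotA 0 2 v t x), rotA 0 1 v t x]

/-- `∂^α` for a multi-index with `|α| ≤ 1`: either the identity or a single `∂_a`. -/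
def Dle1 : Option (Fin 4) → Fn → Fn
  | none => id
  | some a => pda a

/-- A linear combination, with constant real coefficients, of the null forms
`Q_0(u_j, ∂^α u_k; c)` and `Q_{ab}(u_j, ∂^α u_k)` with `0 ≤ a < b ≤ 3`, `|α| ≤ 1`. -/
def NullF (c : ℝ) (m : ℕ)
    (a0 : Fin m → Fin m → Fin m → Option (Fin 4) → ℝ)
    (aQ : Fin m → Fin m → Fin m → Fin 4 → Fin 4 → Option (Fin 4) → ℝ)
    (v : Fin m → Fn) (i : Fin m) : Fn := fun t x =>
  (∑ j, ∑ k, ∑ o : Option (Fin 4), a0 i j k o * Q0f c (v j) (Dle1 o (v k)) t x) +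
    ∑ j, ∑ k, ∑ p ∈ Finset.univ.filter (fun p : Fin 4 × Fin 4 => p.1 < p.2),
      ∑ o : Option (Fin 4), aQ i j k p.1 p.2 o * Qab p.1 p.2 (v j) (Dle1 o (v k)) t x

/-! ### Calculus with the coordinate fields -/

lemma Smooth.hasFDerivAt {f : Fn} (hf : Smooth f) (p : ℝ × E3) :
    HasFDerivAt (fun p : ℝ × E3 => f p.1 p.2) (fderiv ℝ (fun p : ℝ × E3 => f p.1 p.2) p) p :=
  (hf.differentiable (by simp) p).hasFDerivAt

lemma Smooth.pt_eq {f : Fn} (hf : Smooth f) (t : ℝ) (x : E3) :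
    pt f t x = fderiv ℝ (fun p : ℝ × E3 => f p.1 p.2) (t, x) (1, 0) :=
  (HasFDerivAt.comp_hasDerivAt (f := fun s => (s, x)) t (hf.hasFDerivAt (t, x))
    ((hasDerivAt_id t).prodMk (hasDerivAt_const t x))).deriv

lemma Smooth.hasFDerivAt_space {f : Fn} (hf : Smooth f) (t : ℝ) (x : E3) :
    HasFDerivAt (f t) ((fderiv ℝ (fun p : ℝ × E3 => f p.1 p.2) (t, x)).comp
      (ContinuousLinearMap.inr ℝ ℝ E3)) x :=
  (hf.hasFDerivAt (t, x)).comp x (hasFDerivAt_prodMk_right t x)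

lemma Smooth.pd_eq {f : Fn} (hf : Smooth f) (j : Fin 3) (t : ℝ) (x : E3) :
    pd j f t x =
      fderiv ℝ (fun p : ℝ × E3 => f p.1 p.2) (t, x) (0, EuclideanSpace.single j 1) := by
  rw [pd, (hf.hasFDerivAt_space t x).fderiv]
  rfl

lemma contDiff_fderiv_apply {E : Type*} [NormedAddCommGroup E] [NormedSpace ℝ E] {F : E → ℝ}
    (hF : ContDiff ℝ (⊤ : ℕ∞) F) (v : E) : ContDiff ℝ (⊤ : ℕ∞) (fun p => fderiv ℝ F p v) :=
  (hF.fderiv_right (m := (⊤ : ℕ∞)) (by simp)).clm_apply contDiff_const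

lemma Smooth.smooth_pt {f : Fn} (hf : Smooth f) : Smooth (pt f) := by
  have h := contDiff_fderiv_apply hf (1, 0)
  simpa only [Smooth, hf.pt_eq] using h

lemma Smooth.smooth_pd {f : Fn} (hf : Smooth f) (j : Fin 3) : Smooth (pd j f) := by
  have h := contDiff_fderiv_apply hf (0, EuclideanSpace.single j 1)
  simpa only [Smooth, hf.pd_eq] using h

lemma contDiff_coord (j : Fin 3) : ContDiff ℝ (⊤ : ℕ∞) (fun x : E3 => x j) := by
  fun_prop

lemma Smooth.coord_mul {f : Fn} (hf : Smooth f) (j : Fin 3) :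
    Smooth (fun t x => x j * f t x) :=
  ((contDiff_coord j).comp contDiff_snd).mul hf

lemma Smooth.sub {f g : Fn} (hf : Smooth f) (hg : Smooth g) :
    Smooth (fun t x => f t x - g t x) :=
  ContDiff.sub hf hg

lemma Smooth.smooth_rotA {f : Fn} (hf : Smooth f) (j k : Fin 3) : Smooth (rotA j k f) :=
  ((hf.smooth_pd k).coord_mul j).sub ((hf.smooth_pd j).coord_mul k)

lemma Smooth.continuous_comp {f : Fn} (hf : Smooth f) {X : Type*} [TopologicalSpace X]
    {a : X → ℝ} {y : X → E3} (ha : Continuous a) (hy : Continuous y) :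
    Continuous (fun z => f (a z) (y z)) :=
  (ContDiff.continuous hf).comp (ha.prodMk hy)

lemma Smooth.hasDerivAt_comp {f : Fn} (hf : Smooth f) {a : ℝ → ℝ} {y : ℝ → E3} {a' : ℝ}
    {y' : E3} {s : ℝ} (ha : HasDerivAt a a' s) (hy : HasDerivAt y y' s) :
    HasDerivAt (fun s => f (a s) (y s))
      (a' * pt f (a s) (y s) + ∑ j, y' j * pd j f (a s) (y s)) s := by
  have h := (hf.hasFDerivAt (a s, y s)).comp_hasDerivAt s (ha.prodMk hy)
  convert! h using 1
  have h1 : ((a', y') : ℝ × E3) = a' • ((1 : ℝ), (0 : E3)) +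
      ∑ j, y' j • ((0 : ℝ), (EuclideanSpace.single j 1 : E3)) := by
    ext i
    · simp [Prod.fst_sum]
    · fin_cases i <;> simp [Fin.sum_univ_three]
  rw [h1, map_add, map_sum]
  simp only [map_smul, smul_eq_mul, hf.pt_eq, hf.pd_eq]

lemma fderiv_fderiv_apply_comm {E : Type*} [NormedAddCommGroup E] [NormedSpace ℝ E] {F : E → ℝ}
    (hF : ContDiff ℝ (⊤ : ℕ∞) F) (p v w : E) :
    fderiv ℝ (fun q => fderiv ℝ F q v) p w = fderiv ℝ (fun q => fderiv ℝ F q w) p v := by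
  have hd : DifferentiableAt ℝ (fderiv ℝ F) p :=
    (hF.fderiv_right (m := (⊤ : ℕ∞)) (by simp)).differentiable (by simp) p
  have hs : IsSymmSndFDerivAt ℝ F p :=
    hF.contDiffAt.isSymmSndFDerivAt (by simp; exact WithTop.coe_le_coe.2 le_top)
  rw [fderiv_clm_apply hd (differentiableAt_const v), fderiv_clm_apply hd (differentiableAt_const w)]
  simpa using hs w v

lemma Smooth.pd_pd_comm {f : Fn} (hf : Smooth f) (i j : Fin 3) :
    pd i (pd j f) = pd j (pd i f) := by
  funext t x
  rw [(hf.smooth_pd j).pd_eq, (hf.smooth_pd i).pd_eq]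
  simp only [hf.pd_eq]
  exact fderiv_fderiv_apply_comm hf _ _ _

lemma Smooth.pt_pd_comm {f : Fn} (hf : Smooth f) (j : Fin 3) :
    pt (pd j f) = pd j (pt f) := by
  funext t x
  rw [(hf.smooth_pd j).pt_eq, hf.smooth_pt.pd_eq]
  simp only [hf.pd_eq, hf.pt_eq]
  exact fderiv_fderiv_apply_comm hf _ _ _

lemma sd_sd_comm {φ : SFn} (hφ : ContDiff ℝ (⊤ : ℕ∞) φ) (i j : Fin 3) :
    sd i (sd j φ) = sd j (sd i φ) := by
  funext x
  exact fderiv_fderiv_apply_comm hφ _ _ _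

lemma Smooth.pd_sub {f g : Fn} (hf : Smooth f) (hg : Smooth g) (i : Fin 3) :
    pd i (fun t x => f t x - g t x) =
      fun t x => pd i f t x - pd i g t x := by
  funext t x
  simp only [pd]
  have := (hf.hasFDerivAt_space t x).fun_sub (hg.hasFDerivAt_space t x)
  rw [this.fderiv, (hf.hasFDerivAt_space t x).fderiv, (hg.hasFDerivAt_space t x).fderiv]
  rfl

lemma Smooth.pd_coord_mul {f : Fn} (hf : Smooth f) (i j : Fin 3) :
    pd i (fun t x => x j * f t x) =
      fun t x => (if j = i then 1 else 0) * f t x + x j * pd i f t x := by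
  funext t x
  simp only [pd]
  have hc : HasFDerivAt (fun x : E3 => x j) (EuclideanSpace.proj j : E3 →L[ℝ] ℝ) x :=
    (EuclideanSpace.proj j : E3 →L[ℝ] ℝ).hasFDerivAt
  have h := hc.mul (hf.hasFDerivAt_space t x)
  rw [show (fun x : E3 => x j * f t x) = (fun x : E3 => x j) * f t from rfl, h.fderiv,
    (hf.hasFDerivAt_space t x).fderiv]
  by_cases hij : j = i <;> simp [hij, add_comm]

lemma Smooth.pt_sub {f g : Fn} (hf : Smooth f) (hg : Smooth g) :
    pt (fun t x => f t x - g t x) =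
      fun t x => pt f t x - pt g t x := by
  funext t x
  have hid := hasDerivAt_id t
  have hx := hasDerivAt_const t x
  have h := (hf.hasDerivAt_comp hid hx).sub (hg.hasDerivAt_comp hid hx)
  exact h.deriv.trans (by simp)

lemma pt_coord_mul (f : Fn) (j : Fin 3) :
    pt (fun t x => x j * f t x) = fun t x => x j * pt f t x := by
  funext t x
  simp [pt]

lemma Smooth.pt_rotA {f : Fn} (hf : Smooth f) (j k : Fin 3) :
    pt (rotA j k f) =
      rotA j k (pt f) := by
  unfold rotA
  rw [Smooth.pt_sub ((hf.smooth_pd k).coord_mul j) ((hf.smooth_pd j).coord_mul k)]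
  simp only [pt_coord_mul, hf.pt_pd_comm]

lemma Smooth.pd_rotA {f : Fn} (hf : Smooth f) (i j k : Fin 3) :
    pd i (rotA j k f) = fun t x =>
      ((if j = i then 1 else 0) * pd k f t x +
        x j * pd i (pd k f) t x) -
      ((if k = i then 1 else 0) * pd j f t x +
        x k * pd i (pd j f) t x) := by
  unfold rotA
  rw [Smooth.pd_sub ((hf.smooth_pd k).coord_mul j) ((hf.smooth_pd j).coord_mul k), (hf.smooth_pd k).pd_coord_mul,
    (hf.smooth_pd j).pd_coord_mul]

lemma Smooth.const_mul {f : Fn} (hf : Smooth f) (a : ℝ) : Smooth (fun t x => a * f t x) :=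
  contDiff_const.mul hf

lemma Smooth.add {f g : Fn} (hf : Smooth f) (hg : Smooth g) :
    Smooth (fun t x => f t x + g t x) :=
  ContDiff.add hf hg

lemma Smooth.pd_const_mul {f : Fn} (hf : Smooth f) (i : Fin 3) (a : ℝ) :
    pd i (fun t x => a * f t x) = fun t x => a * pd i f t x := by
  funext t x
  simp only [pd]
  have := (hf.hasFDerivAt_space t x).const_mul a
  rw [this.fderiv, (hf.hasFDerivAt_space t x).fderiv]
  rfl

lemma Smooth.pd_add {f g : Fn} (hf : Smooth f) (hg : Smooth g) (i : Fin 3) :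
    pd i (fun t x => f t x + g t x) =
      fun t x => pd i f t x + pd i g t x := by
  funext t x
  simp only [pd]
  have := (hf.hasFDerivAt_space t x).fun_add (hg.hasFDerivAt_space t x)
  rw [this.fderiv, (hf.hasFDerivAt_space t x).fderiv, (hg.hasFDerivAt_space t x).fderiv]
  rfl

/-! ### Fields commuting with the wave operator -/

lemma pd_congr {f g : Fn} {t : ℝ} (h : f t = g t) (j : Fin 3) (x : E3) :
    pd j f t x = pd j g t x := by
  simp only [pd, h]

lemma pd_eq_sd {f : Fn} {t : ℝ} {φ : SFn} (h : ∀ x, f t x = φ x) (j : Fin 3) (x : E3) :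
    pd j f t x = sd j φ x := by
  rw [pd, sd, funext h]

lemma IsFreeWaveSol.wave_eq {c : ℝ} {φ ψ : SFn} {u : Fn} (h : IsFreeWaveSol c φ ψ u) {t : ℝ}
    (ht : 0 ≤ t) (x : E3) :
    pt (pt u) t x = c ^ 2 * ∑ j, pd j (pd j u) t x := by
  obtain ⟨hu, hw, -, -⟩ := h
  have hcont : ∀ {f : Fn}, Smooth f → Continuous fun s => f s x :=
    fun hf => hf.continuous_comp continuous_id continuous_const
  have h1 : Continuous fun s => pt (pt u) s x := hcont hu.smooth_pt.smooth_pt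
  have h2 : Continuous fun s => c ^ 2 * ∑ j, pd j (pd j u) s x :=
    continuous_const.mul
      (continuous_finsetSum _ fun j _ => hcont ((hu.smooth_pd j).smooth_pd j))
  have h3 : Set.EqOn (fun s => pt (pt u) s x) (fun s => c ^ 2 * ∑ j, pd j (pd j u) s x)
      (Set.Ioi 0) := fun s hs => sub_eq_zero.1 (hw s x hs)
  exact h3.closure h1 h2 (by rw [closure_Ioi]; exact ht)

lemma Smooth.pd_laplacian {u : Fn} (hu : Smooth u) (c : ℝ) (k : Fin 3) (t : ℝ) (x : E3) :
    pd k (fun t x => c ^ 2 * ∑ j, pd j (pd j u) t x) t x =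
      c ^ 2 * ∑ j, pd k (pd j (pd j u)) t x := by
  have h := fun j => (hu.smooth_pd j).smooth_pd j
  simp only [Fin.sum_univ_three]
  rw [Smooth.pd_const_mul (((h 0).add (h 1)).add (h 2)), Smooth.pd_add ((h 0).add (h 1)) (h 2),
    Smooth.pd_add (h 0) (h 1)]

lemma IsFreeWaveSol.pd_pt_pt {c : ℝ} {φ ψ : SFn} {u : Fn} (h : IsFreeWaveSol c φ ψ u)
    {t : ℝ} (ht : 0 ≤ t) (k : Fin 3) (x : E3) :
    pd k (pt (pt u)) t x = c ^ 2 * ∑ j, pd k (pd j (pd j u)) t x := by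
  rw [pd_congr (g := fun t x => c ^ 2 * ∑ j, pd j (pd j u) t x)
    (funext fun y => h.wave_eq ht y), h.1.pd_laplacian]

lemma IsFreeWaveSol.spatialDeriv {c : ℝ} {φ ψ : SFn} {u : Fn} (h : IsFreeWaveSol c φ ψ u)
    (k : Fin 3) : IsFreeWaveSol c (sd k φ) (sd k ψ) (pd k u) := by
  have hu := h.1
  refine ⟨hu.smooth_pd k, fun t x ht => ?_, pd_eq_sd h.2.2.1 k, fun x => ?_⟩
  · rw [hu.pt_pd_comm, hu.smooth_pt.pt_pd_comm, h.pd_pt_pt ht.le]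
    simp only [hu.pd_pd_comm _ k, (hu.smooth_pd _).pd_pd_comm _ k, sub_self]
  · rw [hu.pt_pd_comm]
    exact pd_eq_sd h.2.2.2 k x

lemma IsFreeWaveSol.timeDeriv {c : ℝ} {φ ψ : SFn} {u : Fn} (h : IsFreeWaveSol c φ ψ u) :
    IsFreeWaveSol c ψ (fun x => c ^ 2 * ∑ j, sd j (sd j φ) x) (pt u) := by
  have hu := h.1
  refine ⟨hu.smooth_pt, fun t x ht => ?_, h.2.2.2, fun x => ?_⟩
  · have h1 : (fun s => pt (pt u) s x) =ᶠ[nhds t]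
        fun s => c ^ 2 * ∑ j, pd j (pd j u) s x := by
      filter_upwards [Ioi_mem_nhds ht] with s hs using h.wave_eq (le_of_lt hs) x
    have h2 : ∀ j, DifferentiableAt ℝ (fun s => pd j (pd j u) s x) t := fun j =>
      (((hu.smooth_pd j).smooth_pd j).hasDerivAt_comp (hasDerivAt_id t)
        (hasDerivAt_const t x)).differentiableAt
    have h3 : pt (pt (pt u)) t x = c ^ 2 * ∑ j, pt (pd j (pd j u)) t x := by
      rw [pt, h1.deriv_eq, deriv_const_mul _ (DifferentiableAt.fun_sum fun j _ => h2 j),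
        deriv_fun_sum fun j _ => h2 j]
      rfl
    rw [h3]
    simp only [(hu.smooth_pd _).pt_pd_comm, hu.pt_pd_comm, sub_self]
  · rw [h.wave_eq le_rfl]
    simp only [fun j => pd_eq_sd (fun y => pd_eq_sd h.2.2.1 j y) j x]

lemma IsFreeWaveSol.rotation {c : ℝ} {φ ψ : SFn} {u : Fn} (h : IsFreeWaveSol c φ ψ u)
    (j k : Fin 3) : IsFreeWaveSol c (srot j k φ) (srot j k ψ) (rotA j k u) := by
  have hu := h.1
  have hd := fun i => hu.smooth_pd i
  have hdd := fun i l => (hd l).smooth_pd i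
  refine ⟨hu.smooth_rotA j k, fun t x ht => ?_, fun x => ?_, fun x => ?_⟩
  · have h1 : ∀ i, pd i (pd i (rotA j k u)) t x =
        2 * ((if j = i then 1 else 0) * pd i (pd k u) t x) -
          2 * ((if k = i then 1 else 0) * pd i (pd j u) t x) +
        (x j * pd k (pd i (pd i u)) t x - x k * pd j (pd i (pd i u)) t x) := by
      intro i
      have hs : pd i (pd i (rotA j k u)) t x =
          ((if j = i then 1 else 0) * pd i (pd k u) t x +
            ((if j = i then 1 else 0) * pd i (pd k u) t x + x j * pd i (pd i (pd k u)) t x)) -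
          ((if k = i then 1 else 0) * pd i (pd j u) t x +
            ((if k = i then 1 else 0) * pd i (pd j u) t x + x k * pd i (pd i (pd j u)) t x)) := by
        rw [hu.pd_rotA, Smooth.pd_sub (((hd k).const_mul _).add ((hdd i k).coord_mul j))
          (((hd j).const_mul _).add ((hdd i j).coord_mul k)),
          Smooth.pd_add ((hd k).const_mul _) ((hdd i k).coord_mul j),
          Smooth.pd_add ((hd j).const_mul _) ((hdd i j).coord_mul k),
          (hd k).pd_const_mul, (hd j).pd_const_mul, (hdd i k).pd_coord_mul,
          (hdd i j).pd_coord_mul]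
      rw [hs, (hd i).pd_pd_comm k i, (hd i).pd_pd_comm j i, hu.pd_pd_comm k i,
        hu.pd_pd_comm j i]
      ring
    rw [hu.pt_rotA, hu.smooth_pt.pt_rotA, rotA, h.pd_pt_pt ht.le, h.pd_pt_pt ht.le]
    simp only [h1, Finset.sum_add_distrib, Finset.sum_sub_distrib, ← Finset.mul_sum]
    simp only [ite_mul, one_mul, zero_mul, Finset.sum_ite_eq, Finset.mem_univ, if_true]
    rw [hu.pd_pd_comm j k]
    ring
  · simp only [rotA, srot, pd_eq_sd h.2.2.1]
  · rw [hu.pt_rotA]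
    simp only [rotA, srot, pd_eq_sd h.2.2.2]

/-! ### Transport along incoming rays -/

lemma IsFreeWaveSol.hasDerivAt_ray {c : ℝ} {φ ψ : SFn} {u : Fn} (h : IsFreeWaveSol c φ ψ u)
    (x₀ ω : E3) (R : ℝ) {s : ℝ} (hs : 0 ≤ s) :
    HasDerivAt (fun s => (R - c * s) * pt u s (x₀ + (R - c * s) • ω) +
        c * u s (x₀ + (R - c * s) • ω) +
        c * (R - c * s) * ∑ j, ω j * pd j u s (x₀ + (R - c * s) • ω))
      (c ^ 2 * ((R - c * s) * (∑ j, pd j (pd j u) s (x₀ + (R - c * s) • ω) -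
        ∑ i, ∑ j, ω i * ω j * pd i (pd j u) s (x₀ + (R - c * s) • ω)) -
        2 * ∑ j, ω j * pd j u s (x₀ + (R - c * s) • ω))) s := by
  have hu := h.1
  have hlam : HasDerivAt (fun s => R - c * s) (-c) s := by
    simpa using ((hasDerivAt_id s).const_mul c).const_sub R
  have hy : HasDerivAt (fun s => x₀ + (R - c * s) • ω) ((-c) • ω) s :=
    (hlam.smul_const ω).const_add x₀
  have hid := hasDerivAt_id s
  have h1 := hlam.mul (hu.smooth_pt.hasDerivAt_comp hid hy)
  have h2 := (hu.hasDerivAt_comp hid hy).const_mul c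
  have h3 := (hlam.const_mul c).mul (HasDerivAt.fun_sum (u := Finset.univ) fun j _ =>
    ((hu.smooth_pd j).hasDerivAt_comp hid hy).const_mul (ω j))
  refine ((h1.add h2).add h3).congr_deriv ?_
  have hw := h.wave_eq hs (x₀ + (R - c * s) • ω)
  simp only [id, hu.pt_pd_comm, hw]
  simp only [Fin.sum_univ_three, PiLp.smul_apply, smul_eq_mul]
  ring

/-- The sum of the squares of the rotation fields is the angular part of the Laplacian. -/
lemma Smooth.sum_rotA_sq {u : Fn} (hu : Smooth u) (t : ℝ) (x : E3) :
    rotA 0 1 (rotA 0 1 u) t x + rotA 0 2 (rotA 0 2 u) t x + rotA 1 2 (rotA 1 2 u) t x =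
      (∑ i, x i ^ 2) * ∑ j, pd j (pd j u) t x - ∑ i, ∑ j, x i * x j * pd i (pd j u) t x -
        2 * ∑ j, x j * pd j u t x := by
  have h : ∀ j k, rotA j k (rotA j k u) t x =
    x j * pd k (rotA j k u) t x - x k * pd j (rotA j k u) t x := fun _ _ => rfl
  simp only [h, hu.pd_rotA, hu.pd_pd_comm 1 0, hu.pd_pd_comm 2 0, hu.pd_pd_comm 2 1,
    Fin.sum_univ_three]
  simp
  ring

/-! ### Spherical coordinates with respect to an orthonormal basis -/

/-- The point of the unit sphere with polar angle `ϑ` and azimuth `θ`. -/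
def sph (b : OrthonormalBasis (Fin 3) ℝ E3) (ϑ θ : ℝ) : E3 :=
  Real.cos ϑ • b 0 + Real.sin ϑ • (Real.cos θ • b 1 + Real.sin θ • b 2)

/-- The unit tangent vector in the polar direction. -/
def sphPolar (b : OrthonormalBasis (Fin 3) ℝ E3) (ϑ θ : ℝ) : E3 :=
  (-Real.sin ϑ) • b 0 + Real.cos ϑ • (Real.cos θ • b 1 + Real.sin θ • b 2)

/-- The unit tangent vector in the azimuthal direction. -/
def sphAzim (b : OrthonormalBasis (Fin 3) ℝ E3) (θ : ℝ) : E3 :=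
  (-Real.sin θ) • b 1 + Real.cos θ • b 2

/-- The unit vector in the equatorial plane with azimuth `θ`. -/
def sphEq (b : OrthonormalBasis (Fin 3) ℝ E3) (θ : ℝ) : E3 :=
  Real.cos θ • b 1 + Real.sin θ • b 2

section Frame

variable (b : OrthonormalBasis (Fin 3) ℝ E3)

lemma hasDerivAt_sph (ϑ θ : ℝ) :
    HasDerivAt (fun ϑ => sph b ϑ θ) (sphPolar b ϑ θ) ϑ :=
  ((Real.hasDerivAt_cos ϑ).smul_const _).add ((Real.hasDerivAt_sin ϑ).smul_const _)

lemma hasDerivAt_sphPolar (ϑ θ : ℝ) :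
    HasDerivAt (fun ϑ => sphPolar b ϑ θ) (-sph b ϑ θ) ϑ := by
  refine (((Real.hasDerivAt_sin ϑ).neg.smul_const (b 0)).add
    ((Real.hasDerivAt_cos ϑ).smul_const
      (Real.cos θ • b 1 + Real.sin θ • b 2))).congr_deriv ?_
  simp only [sph]
  module

lemma hasDerivAt_sph_azim (ϑ θ : ℝ) :
    HasDerivAt (fun θ => sph b ϑ θ) (Real.sin ϑ • sphAzim b θ) θ :=
  ((((Real.hasDerivAt_cos θ).smul_const (b 1)).add
    ((Real.hasDerivAt_sin θ).smul_const (b 2))).const_smul (Real.sin ϑ)).const_add _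

lemma hasDerivAt_sphAzim (θ : ℝ) : HasDerivAt (fun θ => sphAzim b θ) (-sphEq b θ) θ := by
  refine (((Real.hasDerivAt_sin θ).neg.smul_const (b 1)).add
    ((Real.hasDerivAt_cos θ).smul_const (b 2))).congr_deriv ?_
  simp only [sphEq]
  module

lemma sum_basis_mul_basis (i j : Fin 3) :
    b 0 i * b 0 j + b 1 i * b 1 j + b 2 i * b 2 j = if i = j then 1 else 0 := by
  have h := b.sum_inner_mul_inner (EuclideanSpace.single i 1) (EuclideanSpace.single j 1)
  simp [EuclideanSpace.inner_single_left, EuclideanSpace.inner_single_right,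
    Fin.sum_univ_three] at h
  simpa [eq_comm] using h

lemma sph_complete (ϑ θ : ℝ) (i j : Fin 3) :
    sph b ϑ θ i * sph b ϑ θ j + sphPolar b ϑ θ i * sphPolar b ϑ θ j +
      sphAzim b θ i * sphAzim b θ j = if i = j then 1 else 0 := by
  rw [← sum_basis_mul_basis b i j]
  simp only [sph, sphPolar, sphAzim, PiLp.add_apply, PiLp.smul_apply, smul_eq_mul]
  linear_combination (b 0 i * b 0 j + (Real.cos θ * b 1 i + Real.sin θ * b 2 i) *
      (Real.cos θ * b 1 j + Real.sin θ * b 2 j)) * Real.sin_sq_add_cos_sq ϑ +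
    (b 1 i * b 1 j + b 2 i * b 2 j) * Real.sin_sq_add_cos_sq θ

lemma cos_mul_sphPolar_sub (ϑ θ : ℝ) (i : Fin 3) :
    Real.cos ϑ * sphPolar b ϑ θ i - Real.sin ϑ * sph b ϑ θ i - sphEq b θ i =
      -2 * Real.sin ϑ * sph b ϑ θ i := by
  simp only [sph, sphPolar, sphEq, PiLp.add_apply, PiLp.smul_apply, smul_eq_mul]
  linear_combination (Real.cos θ * b 1 i + Real.sin θ * b 2 i) * Real.sin_sq_add_cos_sq ϑ

lemma norm_add_smul_sph (r R ϑ θ : ℝ) :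
    ‖r • b 0 + R • sph b ϑ θ‖ ^ 2 = r ^ 2 + R ^ 2 + 2 * r * R * Real.cos ϑ := by
  have h := b.sum_sq_norm_inner_right (r • b 0 + R • sph b ϑ θ)
  simp only [Real.norm_eq_abs (inner ℝ _ _), sq_abs] at h
  rw [← h, Fin.sum_univ_three]
  simp [sph, inner_add_right, inner_smul_right, b.inner_eq_ite]
  linear_combination (R ^ 2 * Real.sin ϑ ^ 2) * Real.sin_sq_add_cos_sq θ +
    R ^ 2 * Real.sin_sq_add_cos_sq ϑ

lemma norm_sph (ϑ θ : ℝ) : ‖sph b ϑ θ‖ = 1 := by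
  have h := norm_add_smul_sph b 0 1 ϑ θ
  have h' : ‖sph b ϑ θ‖ ^ 2 = 1 := by simpa using h
  exact (pow_eq_one_iff_of_nonneg (norm_nonneg _) two_ne_zero).1 h'

lemma exists_basis_smul_eq (x : E3) :
    ∃ b : OrthonormalBasis (Fin 3) ℝ E3, x = ‖x‖ • b 0 := by
  by_cases hx : x = 0
  · exact ⟨EuclideanSpace.basisFun (Fin 3) ℝ, by simp [hx]⟩
  · have hx' : ‖x‖ ≠ 0 := norm_ne_zero_iff.2 hx
    have hv : Orthonormal ℝ (({0} : Set (Fin 3)).domRestrict fun _ => ‖x‖⁻¹ • x) := by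
      refine ⟨fun i => ?_, fun i j hij => (hij (Subsingleton.elim i j)).elim⟩
      simp [Set.domRestrict, norm_smul, hx']
    obtain ⟨b, hb⟩ := hv.exists_orthonormalBasis_extension_of_card_eq (by simp)
    exact ⟨b, by rw [hb 0 rfl, smul_smul, mul_inv_cancel₀ hx', one_smul]⟩

end Frame

/-! ### Kirchhoff's formula -/

lemma intervalIntegral_swap_of_continuous {F : ℝ → ℝ → ℝ}
    (hF : Continuous fun p : ℝ × ℝ => F p.1 p.2) (a b c d : ℝ) :
    ∫ x in a..b, ∫ y in c..d, F x y = ∫ y in c..d, ∫ x in a..b, F x y := by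
  refine MeasureTheory.intervalIntegral_intervalIntegral_swap ?_
  exact (hF.continuousOn.integrableOn_compact (isCompact_uIcc.prod isCompact_uIcc)).mono_set
    (Set.prod_mono Set.uIoc_subset_uIcc Set.uIoc_subset_uIcc)

/-- Conservation law: if `∂_s K = ∂_y A + ∂_z B` where `A` vanishes at the ends of the `y`-interval
and `B` is periodic in `z`, then the integral of `K` over the rectangle does not depend on `s`. -/
lemma integral_eq_of_divergence {K K' A A' B B' : ℝ → ℝ → ℝ → ℝ} {T a b c d : ℝ} (hT : 0 ≤ T)
    (hK : ∀ s y z, 0 ≤ s → HasDerivAt (fun s => K s y z) (K' s y z) s)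
    (hA : ∀ s y z, HasDerivAt (fun y => A s y z) (A' s y z) y)
    (hB : ∀ s y z, HasDerivAt (fun z => B s y z) (B' s y z) z)
    (hKc : Continuous fun p : ℝ × ℝ × ℝ => K p.1 p.2.1 p.2.2)
    (hAc : Continuous fun p : ℝ × ℝ × ℝ => A' p.1 p.2.1 p.2.2)
    (hBc : Continuous fun p : ℝ × ℝ × ℝ => B' p.1 p.2.1 p.2.2)
    (hdiv : ∀ s y z, 0 ≤ s → K' s y z = A' s y z + B' s y z)
    (hAb : ∀ s z, A s a z = A s b z) (hBb : ∀ s y, B s y c = B s y d) :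
    ∫ y in a..b, ∫ z in c..d, K T y z = ∫ y in a..b, ∫ z in c..d, K 0 y z := by
  have comp : ∀ {F : ℝ → ℝ → ℝ → ℝ}, (Continuous fun p : ℝ × ℝ × ℝ => F p.1 p.2.1 p.2.2) →
      ∀ {X : Type} [TopologicalSpace X] {f g h : X → ℝ}, Continuous f → Continuous g →
      Continuous h → Continuous fun x => F (f x) (g x) (h x) :=
    fun hF _ _ _ _ _ hf hg hh => hF.comp (hf.prodMk (hg.prodMk hh))
  have hs : ∀ y z, K T y z - K 0 y z =
      (∫ s in (0 : ℝ)..T, A' s y z) + ∫ s in (0 : ℝ)..T, B' s y z := by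
    intro y z
    have hAi : Continuous fun s => A' s y z :=
      comp hAc continuous_id continuous_const continuous_const
    have hBi : Continuous fun s => B' s y z :=
      comp hBc continuous_id continuous_const continuous_const
    rw [← intervalIntegral.integral_add (hAi.intervalIntegrable _ _)
      (hBi.intervalIntegrable _ _)]
    symm
    apply intervalIntegral.integral_eq_sub_of_hasDerivAt (f := fun s => K s y z)
    · intro s hs
      rw [Set.uIcc_of_le hT] at hs
      rw [← hdiv s y z hs.1]
      exact hK s y z hs.1
    · exact (hAi.add hBi).intervalIntegrable _ _
  have cA : Continuous fun p : ℝ × ℝ => ∫ s in (0 : ℝ)..T, A' s p.1 p.2 :=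
    intervalIntegral.continuous_parametric_intervalIntegral_of_continuous'
      (f := fun (p : ℝ × ℝ) s => A' s p.1 p.2)
      (comp hAc continuous_snd (continuous_fst.comp continuous_fst)
        (continuous_snd.comp continuous_fst)) _ _
  have cB : Continuous fun p : ℝ × ℝ => ∫ s in (0 : ℝ)..T, B' s p.1 p.2 :=
    intervalIntegral.continuous_parametric_intervalIntegral_of_continuous'
      (f := fun (p : ℝ × ℝ) s => B' s p.1 p.2)
      (comp hBc continuous_snd (continuous_fst.comp continuous_fst)
        (continuous_snd.comp continuous_fst)) _ _
  have hBzero : ∀ y, ∫ z in c..d, ∫ s in (0 : ℝ)..T, B' s y z = 0 := by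
    intro y
    rw [intervalIntegral_swap_of_continuous (F := fun z s => B' s y z)
      (comp hBc continuous_snd continuous_const continuous_fst)]
    have : ∀ s, ∫ z in c..d, B' s y z = 0 := by
      intro s
      rw [intervalIntegral.integral_eq_sub_of_hasDerivAt (fun z _ => hB s y z)
        ((comp hBc continuous_const continuous_const continuous_id).intervalIntegrable _ _),
        hBb, sub_self]
    simp [this]
  have hAzero : ∀ z, ∫ y in a..b, ∫ s in (0 : ℝ)..T, A' s y z = 0 := by
    intro z
    rw [intervalIntegral_swap_of_continuous (F := fun y s => A' s y z)
      (comp hAc continuous_snd continuous_fst continuous_const)]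
    have : ∀ s, ∫ y in a..b, A' s y z = 0 := by
      intro s
      rw [intervalIntegral.integral_eq_sub_of_hasDerivAt (fun y _ => hA s y z)
        ((comp hAc continuous_const continuous_id continuous_const).intervalIntegrable _ _),
        hAb, sub_self]
    simp [this]
  have hKi : ∀ s y, Continuous fun z => K s y z := fun s y =>
    comp hKc continuous_const continuous_const continuous_id
  have hKi2 : ∀ s, Continuous fun y => ∫ z in c..d, K s y z := fun s =>
    intervalIntegral.continuous_parametric_intervalIntegral_of_continuous'
      (f := fun y z => K s y z) (comp hKc continuous_const continuous_fst continuous_snd) _ _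
  have hin : ∀ y, (∫ z in c..d, K T y z) - ∫ z in c..d, K 0 y z =
      ∫ z in c..d, ∫ s in (0 : ℝ)..T, A' s y z := by
    intro y
    rw [← intervalIntegral.integral_sub ((hKi T y).intervalIntegrable _ _)
      ((hKi 0 y).intervalIntegrable _ _)]
    simp only [hs]
    rw [intervalIntegral.integral_add, hBzero, add_zero]
    · exact (cA.comp (continuous_const.prodMk continuous_id)).intervalIntegrable _ _
    · exact (cB.comp (continuous_const.prodMk continuous_id)).intervalIntegrable _ _
  rw [← sub_eq_zero, ← intervalIntegral.integral_sub ((hKi2 T).intervalIntegrable _ _)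
      ((hKi2 0).intervalIntegrable _ _)]
  simp only [hin]
  rw [intervalIntegral_swap_of_continuous (F := fun y z => ∫ s in (0 : ℝ)..T, A' s y z) cA]
  simp [hAzero]

section Frame

variable (b : OrthonormalBasis (Fin 3) ℝ E3)

@[fun_prop]
lemma continuous_sph_comp {X : Type*} [TopologicalSpace X] {f g : X → ℝ} (hf : Continuous f)
    (hg : Continuous g) : Continuous fun x => sph b (f x) (g x) := by
  unfold sph
  fun_prop

@[fun_prop]
lemma continuous_sphPolar_comp {X : Type*} [TopologicalSpace X] {f g : X → ℝ}
    (hf : Continuous f) (hg : Continuous g) : Continuous fun x => sphPolar b (f x) (g x) := by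
  unfold sphPolar
  fun_prop

@[fun_prop]
lemma continuous_sphAzim_comp {X : Type*} [TopologicalSpace X] {g : X → ℝ}
    (hg : Continuous g) : Continuous fun x => sphAzim b (g x) := by
  unfold sphAzim
  fun_prop

@[fun_prop]
lemma continuous_sphEq_comp {X : Type*} [TopologicalSpace X] {g : X → ℝ}
    (hg : Continuous g) : Continuous fun x => sphEq b (g x) := by
  unfold sphEq
  fun_prop

/-- The angular part of the Laplacian on the sphere of radius `lam`, divided by `lam`, is a
divergence in spherical coordinates. -/
lemma sin_mul_angular_laplacian (D : Fin 3 → ℝ) (H : Fin 3 → Fin 3 → ℝ) (lam ϑ θ : ℝ) :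
    (lam * (∑ j, H j j - ∑ i, ∑ j, sph b ϑ θ i * sph b ϑ θ j * H i j) -
        2 * ∑ j, sph b ϑ θ j * D j) * Real.sin ϑ =
      (Real.cos ϑ * ∑ j, sphPolar b ϑ θ j * D j +
        Real.sin ϑ * ∑ j, (-sph b ϑ θ j * D j +
          sphPolar b ϑ θ j * ∑ i, lam * sphPolar b ϑ θ i * H i j)) +
      ∑ j, (-sphEq b θ j * D j +
        sphAzim b θ j * ∑ i, lam * (Real.sin ϑ * sphAzim b θ i) * H i j) := by
  have h1 := cos_mul_sphPolar_sub b ϑ θ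
  have h2 := sph_complete b ϑ θ
  have e0 := h1 0
  have e1 := h1 1
  have e2 := h1 2
  have c00 := h2 0 0
  have c01 := h2 0 1
  have c02 := h2 0 2
  have c10 := h2 1 0
  have c11 := h2 1 1
  have c12 := h2 1 2
  have c20 := h2 2 0
  have c21 := h2 2 1
  have c22 := h2 2 2
  simp at c00 c01 c02 c10 c11 c12 c20 c21 c22
  simp only [Fin.sum_univ_three]
  linear_combination (-D 0) * e0 - D 1 * e1 - D 2 * e2 - lam * Real.sin ϑ *
    (H 0 0 * c00 + H 0 1 * c01 + H 0 2 * c02 + H 1 0 * c10 + H 1 1 * c11 + H 1 2 * c12 +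
      H 2 0 * c20 + H 2 1 * c21 + H 2 2 * c22)

lemma IsFreeWaveSol.kirchhoff {c : ℝ} {φ ψ : SFn} {u : Fn} (h : IsFreeWaveSol c φ ψ u)
    {T : ℝ} (hT : 0 ≤ T) (x : E3) :
    4 * Real.pi * (c * u T x) = ∫ ϑ in (0 : ℝ)..Real.pi, ∫ θ in (0 : ℝ)..(2 * Real.pi),
      (c * T * ψ (x + (c * T) • sph b ϑ θ) + c * φ (x + (c * T) • sph b ϑ θ) +
        c * (c * T) * ∑ j, sph b ϑ θ j * sd j φ (x + (c * T) • sph b ϑ θ)) * Real.sin ϑ := by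
  have hu := h.1
  have key := integral_eq_of_divergence (a := 0) (b := Real.pi) (c := 0) (d := 2 * Real.pi) hT
    (K := fun s ϑ θ => ((c * T - c * s) * pt u s (x + (c * T - c * s) • sph b ϑ θ) +
        c * u s (x + (c * T - c * s) • sph b ϑ θ) + c * (c * T - c * s) *
          ∑ j, sph b ϑ θ j * pd j u s (x + (c * T - c * s) • sph b ϑ θ)) * Real.sin ϑ)
    (A := fun s ϑ θ => c ^ 2 * (Real.sin ϑ *
      ∑ j, sphPolar b ϑ θ j * pd j u s (x + (c * T - c * s) • sph b ϑ θ)))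
    (B := fun s ϑ θ => c ^ 2 *
      ∑ j, sphAzim b θ j * pd j u s (x + (c * T - c * s) • sph b ϑ θ))
    (fun s ϑ θ hs => (h.hasDerivAt_ray x (sph b ϑ θ) (c * T) hs).mul_const (Real.sin ϑ))
    (A' := fun s ϑ θ => c ^ 2 * (Real.cos ϑ *
        ∑ j, sphPolar b ϑ θ j * pd j u s (x + (c * T - c * s) • sph b ϑ θ) +
        Real.sin ϑ * ∑ j, (-sph b ϑ θ j * pd j u s (x + (c * T - c * s) • sph b ϑ θ) +
          sphPolar b ϑ θ j * ∑ i, (c * T - c * s) * sphPolar b ϑ θ i *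
            pd i (pd j u) s (x + (c * T - c * s) • sph b ϑ θ))))
    (B' := fun s ϑ θ => c ^ 2 *
      ∑ j, (-sphEq b θ j * pd j u s (x + (c * T - c * s) • sph b ϑ θ) +
        sphAzim b θ j * ∑ i, (c * T - c * s) * (Real.sin ϑ * sphAzim b θ i) *
          pd i (pd j u) s (x + (c * T - c * s) • sph b ϑ θ)))
    ?_ ?_ ?_ ?_ ?_ ?_ ?_ ?_
  · simp only [sub_self, zero_smul, zero_mul, mul_zero, add_zero, zero_add,
      sub_zero, intervalIntegral.integral_const, smul_eq_mul,
      intervalIntegral.integral_const_mul, integral_sin, Real.cos_zero, Real.cos_pi] at key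
    simp only [h.2.2.1, h.2.2.2, fun j => pd_eq_sd h.2.2.1 j] at key
    rw [← key]
    ring
  · intro s ϑ θ
    have hy : HasDerivAt (fun ϑ => x + (c * T - c * s) • sph b ϑ θ)
        ((c * T - c * s) • sphPolar b ϑ θ) ϑ :=
      ((hasDerivAt_sph b ϑ θ).fun_const_smul _).const_add x
    have hq : ∀ j, HasDerivAt (fun ϑ => sphPolar b ϑ θ j) (-sph b ϑ θ j) ϑ := fun j =>
      (EuclideanSpace.proj j : E3 →L[ℝ] ℝ).hasFDerivAt.comp_hasDerivAt ϑ
        (hasDerivAt_sphPolar b ϑ θ)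
    refine (((Real.hasDerivAt_sin ϑ).mul (HasDerivAt.fun_sum (u := Finset.univ) fun j _ =>
      (hq j).mul ((hu.smooth_pd j).hasDerivAt_comp (hasDerivAt_const ϑ s) hy))).const_mul
      (c ^ 2)).congr_deriv ?_
    simp
  · intro s ϑ θ
    have hy : HasDerivAt (fun θ => x + (c * T - c * s) • sph b ϑ θ)
        ((c * T - c * s) • Real.sin ϑ • sphAzim b θ) θ :=
      ((hasDerivAt_sph_azim b ϑ θ).fun_const_smul _).const_add x
    have hq : ∀ j, HasDerivAt (fun θ => sphAzim b θ j) (-sphEq b θ j) θ := fun j =>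
      (EuclideanSpace.proj j : E3 →L[ℝ] ℝ).hasFDerivAt.comp_hasDerivAt θ
        (hasDerivAt_sphAzim b θ)
    refine ((HasDerivAt.fun_sum (u := Finset.univ) fun j _ =>
      (hq j).mul ((hu.smooth_pd j).hasDerivAt_comp (hasDerivAt_const θ s) hy)).const_mul
      (c ^ 2)).congr_deriv ?_
    simp
  · have h1 := hu.smooth_pt.continuous_comp (X := ℝ × ℝ × ℝ) (a := fun p => p.1)
      (y := fun p => x + (c * T - c * p.1) • sph b p.2.1 p.2.2) (by fun_prop) (by fun_prop)
    have h2 := hu.continuous_comp (X := ℝ × ℝ × ℝ) (a := fun p => p.1)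
      (y := fun p => x + (c * T - c * p.1) • sph b p.2.1 p.2.2) (by fun_prop) (by fun_prop)
    have h3 := fun j => (hu.smooth_pd j).continuous_comp (X := ℝ × ℝ × ℝ) (a := fun p => p.1)
      (y := fun p => x + (c * T - c * p.1) • sph b p.2.1 p.2.2) (by fun_prop) (by fun_prop)
    have h5 : Continuous fun p : ℝ × ℝ × ℝ =>
        ∑ j, sph b p.2.1 p.2.2 j * pd j u p.1 (x + (c * T - c * p.1) • sph b p.2.1 p.2.2) := by
      fun_prop
    exact ((((by fun_prop : Continuous fun p : ℝ × ℝ × ℝ => c * T - c * p.1).mul h1).add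
      (h2.const_mul c)).add ((by fun_prop : Continuous fun p : ℝ × ℝ × ℝ =>
        c * (c * T - c * p.1)).mul h5)).mul (by fun_prop)
  · have h3 := fun j => (hu.smooth_pd j).continuous_comp (X := ℝ × ℝ × ℝ) (a := fun p => p.1)
      (y := fun p => x + (c * T - c * p.1) • sph b p.2.1 p.2.2) (by fun_prop) (by fun_prop)
    have h4 := fun i j => ((hu.smooth_pd j).smooth_pd i).continuous_comp (X := ℝ × ℝ × ℝ)
      (a := fun p => p.1)
      (y := fun p => x + (c * T - c * p.1) • sph b p.2.1 p.2.2) (by fun_prop) (by fun_prop)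
    fun_prop
  · have h3 := fun j => (hu.smooth_pd j).continuous_comp (X := ℝ × ℝ × ℝ) (a := fun p => p.1)
      (y := fun p => x + (c * T - c * p.1) • sph b p.2.1 p.2.2) (by fun_prop) (by fun_prop)
    have h4 := fun i j => ((hu.smooth_pd j).smooth_pd i).continuous_comp (X := ℝ × ℝ × ℝ)
      (a := fun p => p.1)
      (y := fun p => x + (c * T - c * p.1) • sph b p.2.1 p.2.2) (by fun_prop) (by fun_prop)
    fun_prop
  · intro s ϑ θ _
    have := sin_mul_angular_laplacian b
      (fun j => pd j u s (x + (c * T - c * s) • sph b ϑ θ))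
      (fun i j => pd i (pd j u) s (x + (c * T - c * s) • sph b ϑ θ)) (c * T - c * s) ϑ θ
    rw [mul_assoc, this, mul_add]
  · intro s θ
    simp
  · intro s ϑ
    simp [sphAzim, sph]

end Frame

/-! ### The Japanese bracket -/

lemma one_le_jb (a : ℝ) : 1 ≤ jb a := by
  rw [jb, Real.one_le_sqrt]
  nlinarith [sq_nonneg a]

lemma jb_pos (a : ℝ) : 0 < jb a := zero_lt_one.trans_le (one_le_jb a)

lemma jb_sq (a : ℝ) : jb a ^ 2 = 1 + a ^ 2 := Real.sq_sqrt (by positivity)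

lemma jb_le_of_abs_le {a b : ℝ} (h : |a| ≤ b) : jb a ≤ jb b := by
  apply Real.sqrt_le_sqrt
  have := sq_le_sq' (neg_le_of_abs_le h) (le_of_abs_le h)
  linarith

lemma jb_le {a b : ℝ} (h : |a| ≤ b) : jb a ≤ 1 + b := by
  have hb := (abs_nonneg a).trans h
  have h2 := sq_le_sq' (neg_le_of_abs_le h) (le_of_abs_le h)
  rw [jb, Real.sqrt_le_left (by positivity)]
  nlinarith

lemma one_add_le_jb {a : ℝ} : 1 + a ≤ 2 * jb a := by
  have h1 := one_le_jb a
  have h2 : a ≤ jb a := Real.le_sqrt_of_sq_le (by linarith)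
  linarith

lemma jb_rpow (a ρ : ℝ) : jb a ^ ρ = (1 + a ^ 2) ^ (ρ / 2) := by
  rw [jb, Real.sqrt_eq_rpow, ← Real.rpow_mul (by positivity)]
  congr 1
  ring

lemma continuous_jb_rpow (ρ : ℝ) : Continuous fun a => jb a ^ ρ := by
  simp only [jb_rpow]
  exact (by fun_prop : Continuous fun a : ℝ => 1 + a ^ 2).rpow_const
    fun a => Or.inl (by positivity)

lemma integrable_jb_rpow {μ : ℝ} (hμ : 0 < μ) :
    MeasureTheory.Integrable fun z : ℝ => jb z ^ (-1 - μ) := by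
  have h := integrable_rpow_neg_one_add_norm_sq (E := ℝ) (μ := MeasureTheory.volume)
    (r := 1 + μ) (by simp [hμ])
  convert! h using 2 with z
  rw [jb_rpow, Real.norm_eq_abs, sq_abs]
  congr 1
  ring

lemma intervalIntegral_jb_rpow_le {μ : ℝ} (hμ : 0 < μ) {a b : ℝ} (hab : a ≤ b) :
    ∫ z in a..b, jb z ^ (-1 - μ) ≤ ∫ z, jb z ^ (-1 - μ) := by
  rw [intervalIntegral.integral_of_le hab]
  exact MeasureTheory.setIntegral_le_integral (integrable_jb_rpow hμ)
    (Filter.Eventually.of_forall fun z => Real.rpow_nonneg (jb_pos z).le _)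

/-! ### Pointwise decay of free waves -/

lemma one_add_sub_sq_le {r R ϑ : ℝ} (hr : 0 ≤ r) (hR : 0 ≤ R) :
    1 + (r - R) ^ 2 ≤ 1 + (r ^ 2 + R ^ 2 + 2 * r * R * Real.cos ϑ) := by
  nlinarith [mul_nonneg hr hR, Real.neg_one_le_cos ϑ]

lemma continuous_angular_weight {r R : ℝ} (ρ : ℝ) (hr : 0 ≤ r) (hR : 0 ≤ R) :
    Continuous fun ϑ => (1 + (r ^ 2 + R ^ 2 + 2 * r * R * Real.cos ϑ)) ^ ρ * Real.sin ϑ := by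
  refine Continuous.mul (Continuous.rpow_const (by fun_prop) fun ϑ => Or.inl ?_)
    Real.continuous_sin
  have := one_add_sub_sq_le (ϑ := ϑ) hr hR
  have : 0 < 1 + (r - R) ^ 2 := by positivity
  linarith

lemma angular_integral_le {ρ r R : ℝ} (hρ : 2 < ρ) (hr : 0 ≤ r) (hR : 0 ≤ R) :
    (1 + R) * (1 + r + R) * ∫ ϑ in (0 : ℝ)..Real.pi,
      (1 + (r ^ 2 + R ^ 2 + 2 * r * R * Real.cos ϑ)) ^ (-ρ / 2) * Real.sin ϑ ≤
      (6 + 6 / (ρ - 2)) * (1 + (r - R) ^ 2) ^ (1 - ρ / 2) := by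
  set J := ∫ ϑ in (0 : ℝ)..Real.pi,
      (1 + (r ^ 2 + R ^ 2 + 2 * r * R * Real.cos ϑ)) ^ (-ρ / 2) * Real.sin ϑ with hJ
  set D := 1 + (r - R) ^ 2 with hD
  have hDpos : 0 < D := by positivity
  have hle : ∀ ϑ, D ≤ 1 + (r ^ 2 + R ^ 2 + 2 * r * R * Real.cos ϑ) :=
    fun ϑ => one_add_sub_sq_le hr hR
  have hcont := continuous_angular_weight (-ρ / 2) hr hR
  have hJ0 : 0 ≤ J := intervalIntegral.integral_nonneg Real.pi_pos.le fun ϑ hϑ =>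
    mul_nonneg (Real.rpow_nonneg (hDpos.le.trans (hle ϑ)) _)
      (Real.sin_nonneg_of_mem_Icc hϑ)
  have h1 : D * J ≤ 2 * D ^ (1 - ρ / 2) := by
    have : J ≤ ∫ ϑ in (0 : ℝ)..Real.pi, D ^ (-ρ / 2) * Real.sin ϑ := by
      apply intervalIntegral.integral_mono_on Real.pi_pos.le (hcont.intervalIntegrable _ _)
        ((continuous_const.mul Real.continuous_sin).intervalIntegrable _ _)
      intro ϑ hϑ
      exact mul_le_mul_of_nonneg_right
        (Real.rpow_le_rpow_of_nonpos hDpos (hle ϑ) (by linarith))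
        (Real.sin_nonneg_of_mem_Icc hϑ)
    rw [intervalIntegral.integral_const_mul, integral_sin] at this
    have h2 : D * D ^ (-ρ / 2) = D ^ (1 - ρ / 2) := by
      rw [← Real.rpow_one_add' hDpos.le (by linarith)]
      congr 1
      ring
    have h3 := mul_le_mul_of_nonneg_left this hDpos.le
    simp only [Real.cos_zero, Real.cos_pi] at h3
    calc D * J ≤ _ := h3
      _ = 2 * (D * D ^ (-ρ / 2)) := by ring
      _ = _ := by rw [h2]
  have h2 : r * R * J ≤ D ^ (1 - ρ / 2) / (ρ - 2) := by
    have hderiv : ∀ ϑ ∈ Set.uIcc 0 Real.pi,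
        HasDerivAt (fun ϑ => (1 + (r ^ 2 + R ^ 2 + 2 * r * R * Real.cos ϑ)) ^ (1 - ρ / 2))
          ((ρ - 2) * (r * R) *
            ((1 + (r ^ 2 + R ^ 2 + 2 * r * R * Real.cos ϑ)) ^ (-ρ / 2) * Real.sin ϑ)) ϑ := by
      intro ϑ _
      have hb := (((Real.hasDerivAt_cos ϑ).const_mul (2 * r * R)).const_add
        (r ^ 2 + R ^ 2)).const_add 1
      refine (hb.rpow_const (p := 1 - ρ / 2)
        (Or.inl (hDpos.trans_le (hle ϑ)).ne')).congr_deriv ?_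
      rw [show 1 - ρ / 2 - 1 = -ρ / 2 by ring]
      ring
    have hint := intervalIntegral.integral_eq_sub_of_hasDerivAt hderiv
      ((hcont.const_mul _).intervalIntegrable _ _)
    rw [intervalIntegral.integral_const_mul, ← hJ, Real.cos_pi] at hint
    have h0 : 0 ≤ (1 + (r ^ 2 + R ^ 2 + 2 * r * R * Real.cos 0)) ^ (1 - ρ / 2) :=
      Real.rpow_nonneg (hDpos.le.trans (hle 0)) _
    rw [show 1 + (r ^ 2 + R ^ 2 + 2 * r * R * -1) = D by rw [hD]; ring] at hint
    rw [le_div_iff₀ (by linarith)]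
    nlinarith
  have h3 : (1 + R) * (1 + r + R) ≤ 3 * D + 6 * (r * R) := by
    rw [hD]
    nlinarith [sq_nonneg (r - 1), sq_nonneg (R - 1), sq_nonneg (r - R)]
  calc (1 + R) * (1 + r + R) * J ≤ (3 * D + 6 * (r * R)) * J :=
        mul_le_mul_of_nonneg_right h3 hJ0
    _ = 3 * (D * J) + 6 * (r * R * J) := by ring
    _ ≤ 3 * (2 * D ^ (1 - ρ / 2)) + 6 * (D ^ (1 - ρ / 2) / (ρ - 2)) := by gcongr
    _ = _ := by ring

lemma abs_apply_le_norm (x : E3) (j : Fin 3) : |x j| ≤ ‖x‖ := by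
  simpa using PiLp.norm_apply_le x j

lemma abs_sum_unit_mul_le {ω : E3} (hω : ‖ω‖ = 1) {D : Fin 3 → ℝ} {m : ℝ}
    (hD : ∀ j, |D j| ≤ m) : |∑ j, ω j * D j| ≤ 3 * m := by
  have h : ∀ j, |ω j * D j| ≤ m := fun j => by
    rw [abs_mul]
    have h1 := abs_apply_le_norm ω j
    rw [hω] at h1
    nlinarith [abs_nonneg (ω j), abs_nonneg (D j), hD j]
  calc |∑ j, ω j * D j| ≤ ∑ j, |ω j * D j| := Finset.abs_sum_le_sum_abs _ _
    _ ≤ ∑ _j : Fin 3, m := Finset.sum_le_sum fun j _ => h j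
    _ = 3 * m := by simp

lemma abs_conormal_le {c R m p f : ℝ} {ω : E3} {D : Fin 3 → ℝ} (hc : 0 < c) (hR : 0 ≤ R)
    (hω : ‖ω‖ = 1) (hp : |p| ≤ m) (hf : |f| ≤ m) (hD : ∀ j, |D j| ≤ m) :
    |R * p + c * f + c * R * ∑ j, ω j * D j| ≤ (1 + 4 * c) * (1 + R) * m := by
  have h3 := abs_sum_unit_mul_le hω hD
  have hm := (abs_nonneg p).trans hp
  calc |R * p + c * f + c * R * ∑ j, ω j * D j|
      ≤ |R * p| + |c * f| + |c * R * ∑ j, ω j * D j| := abs_add_three _ _ _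
    _ = R * |p| + c * |f| + c * R * |∑ j, ω j * D j| := by
        rw [abs_mul, abs_mul, abs_mul, abs_of_nonneg hR, abs_of_pos hc,
          abs_of_nonneg (mul_nonneg hc.le hR)]
    _ ≤ R * m + c * m + c * R * (3 * m) := by gcongr
    _ ≤ (1 + 4 * c) * (1 + R) * m := by
        nlinarith [mul_nonneg hc.le hm, mul_nonneg hR hm, mul_nonneg (mul_nonneg hc.le hR) hm]

/-- The constant in the decay estimate for free waves. -/
def decayConst (c ρ : ℝ) : ℝ := (1 + 4 * c) / (2 * c) * (6 + 6 / (ρ - 2))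

lemma decayConst_pos {c ρ : ℝ} (hc : 0 < c) (hρ : 2 < ρ) : 0 < decayConst c ρ := by
  have : 0 < ρ - 2 := by linarith
  unfold decayConst
  positivity

lemma IsFreeWaveSol.abs_le {c ρ M T : ℝ} {φ ψ : SFn} {u : Fn} (h : IsFreeWaveSol c φ ψ u)
    (hc : 0 < c) (hρ : 2 < ρ) (hT : 0 ≤ T) (x : E3)
    (hφ : ∀ y, ‖y - x‖ ≤ c * T → |φ y| ≤ M * jb ‖y‖ ^ (-ρ))
    (hdφ : ∀ j y, ‖y - x‖ ≤ c * T → |sd j φ y| ≤ M * jb ‖y‖ ^ (-ρ))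
    (hψ : ∀ y, ‖y - x‖ ≤ c * T → |ψ y| ≤ M * jb ‖y‖ ^ (-ρ)) :
    (1 + (‖x‖ + c * T)) * |u T x| ≤ decayConst c ρ * M * jb (c * T - ‖x‖) ^ (2 - ρ) := by
  obtain ⟨b, hb⟩ := exists_basis_smul_eq x
  have hK := h.kirchhoff b hT x
  set r := ‖x‖ with hr
  set R := c * T with hRdef
  have hr0 : 0 ≤ r := norm_nonneg x
  have hR0 : 0 ≤ R := mul_nonneg hc.le hT
  have hM : 0 ≤ M := by
    have h1 := (abs_nonneg _).trans (hφ x (by simpa using hR0))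
    exact nonneg_of_mul_nonneg_left h1 (Real.rpow_pos_of_pos (jb_pos _) _)
  set J := ∫ ϑ in (0 : ℝ)..Real.pi,
      (1 + (r ^ 2 + R ^ 2 + 2 * r * R * Real.cos ϑ)) ^ (-ρ / 2) * Real.sin ϑ with hJ
  have hnorm : ∀ ϑ θ, jb ‖x + R • sph b ϑ θ‖ ^ (-ρ) =
      (1 + (r ^ 2 + R ^ 2 + 2 * r * R * Real.cos ϑ)) ^ (-ρ / 2) := by
    intro ϑ θ
    rw [jb_rpow, ← norm_add_smul_sph b r R ϑ θ, ← hb]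
  have hball : ∀ ϑ θ, ‖x + R • sph b ϑ θ - x‖ ≤ R := by
    intro ϑ θ
    rw [add_sub_cancel_left, norm_smul, norm_sph, mul_one, Real.norm_eq_abs, abs_of_nonneg hR0]
  have hbound : 4 * Real.pi * (c * |u T x|) ≤
      2 * Real.pi * ((1 + 4 * c) * (1 + R) * M) * J := by
    have habs : 4 * Real.pi * (c * |u T x|) = ‖4 * Real.pi * (c * u T x)‖ := by
      rw [Real.norm_eq_abs, abs_mul, abs_mul c, abs_of_pos hc,
        abs_of_pos (by positivity : 0 < 4 * Real.pi)]
    rw [habs, hK, hJ, ← intervalIntegral.integral_const_mul]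
    refine intervalIntegral.norm_integral_le_of_norm_le Real.pi_pos.le
      (Filter.Eventually.of_forall fun ϑ hϑ => ?_)
      (((continuous_angular_weight (-ρ / 2) hr0 hR0).const_mul _).intervalIntegrable _ _)
    have hsin : 0 ≤ Real.sin ϑ := Real.sin_nonneg_of_mem_Icc ⟨hϑ.1.le, hϑ.2⟩
    refine (intervalIntegral.norm_integral_le_of_norm_le_const (C := (1 + 4 * c) * (1 + R) *
      (M * (1 + (r ^ 2 + R ^ 2 + 2 * r * R * Real.cos ϑ)) ^ (-ρ / 2)) * Real.sin ϑ)
      fun θ _ => ?_).trans_eq ?_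
    · rw [Real.norm_eq_abs, abs_mul, abs_of_nonneg hsin, ← hnorm ϑ θ]
      exact mul_le_mul_of_nonneg_right (abs_conormal_le hc hR0 (norm_sph b ϑ θ)
        (hψ _ (hball ϑ θ)) (hφ _ (hball ϑ θ)) fun j => hdφ j _ (hball ϑ θ)) hsin
    · rw [sub_zero, abs_of_pos (by positivity)]
      ring
  have hang := angular_integral_le hρ hr0 hR0
  rw [← hJ] at hang
  have hjb : jb (R - r) ^ (2 - ρ) = (1 + (r - R) ^ 2) ^ (1 - ρ / 2) := by
    rw [jb_rpow]
    congr 1 <;> ring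
  have h1 : c * |u T x| ≤ (1 + 4 * c) / 2 * M * ((1 + R) * J) := by
    have hpi := Real.pi_pos
    refine le_of_mul_le_mul_left ?_ (by positivity : 0 < 4 * Real.pi)
    calc _ ≤ _ := hbound
      _ = _ := by ring
  rw [hjb, decayConst]
  calc (1 + (r + R)) * |u T x| = (1 + (r + R)) * (c * |u T x|) / c := by field_simp
    _ ≤ (1 + (r + R)) * ((1 + 4 * c) / 2 * M * ((1 + R) * J)) / c := by gcongr
    _ = (1 + 4 * c) / (2 * c) * M * ((1 + R) * (1 + r + R) * J) := by field_simp; ring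
    _ ≤ (1 + 4 * c) / (2 * c) * M *
        ((6 + 6 / (ρ - 2)) * (1 + (r - R) ^ 2) ^ (1 - ρ / 2)) := by gcongr
    _ = _ := by ring

/-! ### Control of the data by `Bfun` -/

lemma contDiff_sd {φ : SFn} (hφ : ContDiff ℝ (⊤ : ℕ∞) φ) (j : Fin 3) :
    ContDiff ℝ (⊤ : ℕ∞) (sd j φ) :=
  contDiff_fderiv_apply hφ _

lemma contDiff_srot {φ : SFn} (hφ : ContDiff ℝ (⊤ : ℕ∞) φ) (j k : Fin 3) :
    ContDiff ℝ (⊤ : ℕ∞) (srot j k φ) :=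
  ((contDiff_coord j).mul (contDiff_sd hφ k)).sub ((contDiff_coord k).mul (contDiff_sd hφ j))

lemma contDiff_Sop {φ : SFn} (hφ : ContDiff ℝ (⊤ : ℕ∞) φ) (i : Fin 6) :
    ContDiff ℝ (⊤ : ℕ∞) (Sop i φ) := by
  fin_cases i
  exacts [contDiff_sd hφ 0, contDiff_sd hφ 1, contDiff_sd hφ 2, contDiff_srot hφ 0 1,
    contDiff_srot hφ 0 2, contDiff_srot hφ 1 2]

lemma contDiff_Sop_iterate {φ : SFn} (hφ : ContDiff ℝ (⊤ : ℕ∞) φ) (i : Fin 6) (n : ℕ) :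
    ContDiff ℝ (⊤ : ℕ∞) ((Sop i)^[n] φ) := by
  induction n with
  | zero => exact hφ
  | succ n ih =>
    rw [Function.iterate_succ_apply']
    exact contDiff_Sop ih i

lemma contDiff_Spow {φ : SFn} (hφ : ContDiff ℝ (⊤ : ℕ∞) φ) (α : Fin 6 → ℕ) :
    ContDiff ℝ (⊤ : ℕ∞) (Spow α φ) := by
  unfold Spow
  iterate 6 refine contDiff_Sop_iterate ?_ _ _
  exact hφ

lemma continuous_snorm {φ : SFn} (hφ : ContDiff ℝ (⊤ : ℕ∞) φ) (s : ℕ) :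
    Continuous (snorm s φ) :=
  continuous_finsetSum _ fun α _ => (contDiff_Spow hφ α).continuous.abs

lemma snorm_nonneg (s : ℕ) (φ : SFn) (y : E3) : 0 ≤ snorm s φ y :=
  Finset.sum_nonneg fun _ _ => abs_nonneg _

lemma abs_Spow_le_snorm {s : ℕ} {α : Fin 6 → ℕ} (hα : ∑ i, α i ≤ s) (φ : SFn) (y : E3) :
    |Spow α φ y| ≤ snorm s φ y := by
  refine Finset.single_le_sum (f := fun α => |Spow α φ y|) (fun _ _ => abs_nonneg _) ?_
  simp only [smultiIdx, Finset.mem_filter, Fintype.mem_piFinset, Finset.mem_range]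
  exact ⟨fun i => Nat.lt_succ_of_le
    ((Finset.single_le_sum (fun _ _ => Nat.zero_le _) (Finset.mem_univ i)).trans hα), hα⟩

lemma abs_le_snorm (s : ℕ) (φ : SFn) (y : E3) : |φ y| ≤ snorm s φ y :=
  abs_Spow_le_snorm (α := 0) (by simp) φ y

lemma abs_sd_le_snorm {s : ℕ} (hs : 1 ≤ s) (j : Fin 3) (φ : SFn) (y : E3) :
    |sd j φ y| ≤ snorm s φ y := by
  fin_cases j
  · exact abs_Spow_le_snorm (α := ![1, 0, 0, 0, 0, 0]) (by simpa [Fin.sum_univ_succ] using hs) φ y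
  · exact abs_Spow_le_snorm (α := ![0, 1, 0, 0, 0, 0]) (by simpa [Fin.sum_univ_succ] using hs) φ y
  · exact abs_Spow_le_snorm (α := ![0, 0, 1, 0, 0, 0]) (by simpa [Fin.sum_univ_succ] using hs) φ y

lemma abs_sd_sd_le_snorm {s : ℕ} (hs : 2 ≤ s) {φ : SFn} (hφ : ContDiff ℝ (⊤ : ℕ∞) φ)
    (i j : Fin 3) (y : E3) : |sd i (sd j φ) y| ≤ snorm s φ y := by
  wlog hij : i ≤ j generalizing i j
  · rw [sd_sd_comm hφ]
    exact this j i (le_of_not_ge hij)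
  fin_cases i <;> fin_cases j <;> first | (exfalso; revert hij; decide) | skip
  · exact abs_Spow_le_snorm (α := ![2, 0, 0, 0, 0, 0]) (by simpa [Fin.sum_univ_succ] using hs) φ y
  · exact abs_Spow_le_snorm (α := ![1, 1, 0, 0, 0, 0]) (by simpa [Fin.sum_univ_succ] using hs) φ y
  · exact abs_Spow_le_snorm (α := ![1, 0, 1, 0, 0, 0]) (by simpa [Fin.sum_univ_succ] using hs) φ y
  · exact abs_Spow_le_snorm (α := ![0, 2, 0, 0, 0, 0]) (by simpa [Fin.sum_univ_succ] using hs) φ y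
  · exact abs_Spow_le_snorm (α := ![0, 1, 1, 0, 0, 0]) (by simpa [Fin.sum_univ_succ] using hs) φ y
  · exact abs_Spow_le_snorm (α := ![0, 0, 2, 0, 0, 0]) (by simpa [Fin.sum_univ_succ] using hs) φ y

lemma exists_Sop_eq_srot {j k : Fin 3} (hjk : j < k) : ∃ a : Fin 6, 3 ≤ a ∧ Sop a = srot j k := by
  fin_cases j <;> fin_cases k <;> first | (exfalso; revert hjk; decide) | skip
  exacts [⟨3, by decide, rfl⟩, ⟨4, by decide, rfl⟩, ⟨5, by decide, rfl⟩]

lemma abs_srot_srot_le_snorm {s : ℕ} (hs : 2 ≤ s) {j k : Fin 3} (hjk : j < k) (φ : SFn) (y : E3) :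
    |srot j k (srot j k φ) y| ≤ snorm s φ y := by
  obtain ⟨a, -, ha⟩ := exists_Sop_eq_srot hjk
  rw [← ha]
  have h := abs_Spow_le_snorm (s := s) (α := Pi.single a 2) (by simpa using hs) φ y
  fin_cases a <;> exact h

lemma abs_sd_srot_srot_le_snorm {s : ℕ} (hs : 3 ≤ s) {j k : Fin 3} (hjk : j < k) (i : Fin 3)
    (φ : SFn) (y : E3) : |sd i (srot j k (srot j k φ)) y| ≤ snorm s φ y := by
  obtain ⟨a, ha3, ha⟩ := exists_Sop_eq_srot hjk
  rw [← ha]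
  have h := abs_Spow_le_snorm (s := s) (α := Pi.single (i.castLE (by norm_num)) 1 + Pi.single a 2)
    (by simpa [Finset.sum_add_distrib] using hs) φ y
  fin_cases a <;> first | (exfalso; revert ha3; decide) | skip
  all_goals fin_cases i <;> exact h

lemma snorm_add_snorm_le {φ ψ : SFn} (hφ : ContDiff ℝ (⊤ : ℕ∞) φ) (hψ : ContDiff ℝ (⊤ : ℕ∞) ψ)
    (ρ : ℝ) (s : ℕ) (c t : ℝ) (x : E3) {y : E3} (hy : ‖y - x‖ ≤ c * t) :
    snorm (s + 1) φ y + snorm s ψ y ≤ Bfun ρ s φ ψ c t x * jb ‖y‖ ^ (-ρ) := by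
  have hpos : 0 < jb ‖y‖ ^ ρ := Real.rpow_pos_of_pos (jb_pos _) _
  rw [Real.rpow_neg (jb_pos _).le, ← div_eq_mul_inv, le_div_iff₀ hpos, mul_comm]
  refine le_csSup ?_ ⟨y, hy, rfl⟩
  have hcont : Continuous fun y : E3 => jb ‖y‖ ^ ρ * (snorm (s + 1) φ y + snorm s ψ y) :=
    ((continuous_jb_rpow ρ).comp continuous_norm).mul
      ((continuous_snorm hφ _).add (continuous_snorm hψ _))
  refine ((isCompact_closedBall x (c * t)).bddAbove_image hcont.continuousOn).mono ?_
  rintro _ ⟨z, hz, rfl⟩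
  exact ⟨z, by simpa [dist_eq_norm] using hz, rfl⟩

/-! ### Decay of the derivatives of a free wave -/

section Cone

variable {c ρ M T : ℝ} {φ ψ : SFn} {u : Fn} {x : E3}

lemma IsFreeWaveSol.abs_le_of_snorm (h : IsFreeWaveSol c φ ψ u) (hc : 0 < c) (hρ : 2 < ρ)
    (hT : 0 ≤ T)
    (hB : ∀ y, ‖y - x‖ ≤ c * T → snorm 3 φ y + snorm 2 ψ y ≤ M * jb ‖y‖ ^ (-ρ)) :
    (1 + (‖x‖ + c * T)) * |u T x| ≤ decayConst c ρ * M * jb (c * T - ‖x‖) ^ (2 - ρ) :=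
  h.abs_le hc hρ hT x
    (fun y hy => by linarith [hB y hy, abs_le_snorm 3 φ y, snorm_nonneg 2 ψ y])
    (fun j y hy => by
      linarith [hB y hy, abs_sd_le_snorm (s := 3) (by norm_num) j φ y, snorm_nonneg 2 ψ y])
    (fun y hy => by linarith [hB y hy, abs_le_snorm 2 ψ y, snorm_nonneg 3 φ y])

lemma IsFreeWaveSol.abs_pd_le (h : IsFreeWaveSol c φ ψ u) (hφ : ContDiff ℝ (⊤ : ℕ∞) φ)
    (hc : 0 < c) (hρ : 2 < ρ) (hT : 0 ≤ T)
    (hB : ∀ y, ‖y - x‖ ≤ c * T → snorm 3 φ y + snorm 2 ψ y ≤ M * jb ‖y‖ ^ (-ρ)) (k : Fin 3) :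
    (1 + (‖x‖ + c * T)) * |pd k u T x| ≤ decayConst c ρ * M * jb (c * T - ‖x‖) ^ (2 - ρ) :=
  (h.spatialDeriv k).abs_le hc hρ hT x
    (fun y hy => by
      linarith [hB y hy, abs_sd_le_snorm (s := 3) (by norm_num) k φ y, snorm_nonneg 2 ψ y])
    (fun j y hy => by
      linarith [hB y hy, abs_sd_sd_le_snorm (s := 3) (by norm_num) hφ j k y, snorm_nonneg 2 ψ y])
    (fun y hy => by
      linarith [hB y hy, abs_sd_le_snorm (s := 2) (by norm_num) k ψ y, snorm_nonneg 3 φ y])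

lemma IsFreeWaveSol.abs_rotA_rotA_le (h : IsFreeWaveSol c φ ψ u) (hc : 0 < c) (hρ : 2 < ρ)
    (hT : 0 ≤ T)
    (hB : ∀ y, ‖y - x‖ ≤ c * T → snorm 3 φ y + snorm 2 ψ y ≤ M * jb ‖y‖ ^ (-ρ))
    {j k : Fin 3} (hjk : j < k) :
    (1 + (‖x‖ + c * T)) * |rotA j k (rotA j k u) T x| ≤
      decayConst c ρ * M * jb (c * T - ‖x‖) ^ (2 - ρ) :=
  ((h.rotation j k).rotation j k).abs_le hc hρ hT x
    (fun y hy => by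
      linarith [hB y hy, abs_srot_srot_le_snorm (s := 3) (by norm_num) hjk φ y,
        snorm_nonneg 2 ψ y])
    (fun i y hy => by
      linarith [hB y hy, abs_sd_srot_srot_le_snorm (s := 3) le_rfl hjk i φ y,
        snorm_nonneg 2 ψ y])
    (fun y hy => by
      linarith [hB y hy, abs_srot_srot_le_snorm (s := 2) le_rfl hjk ψ y, snorm_nonneg 3 φ y])

lemma IsFreeWaveSol.abs_pt_le (h : IsFreeWaveSol c φ ψ u) (hφ : ContDiff ℝ (⊤ : ℕ∞) φ)
    (hc : 0 < c) (hρ : 2 < ρ) (hT : 0 ≤ T)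
    (hB : ∀ y, ‖y - x‖ ≤ c * T → snorm 3 φ y + snorm 2 ψ y ≤ M * jb ‖y‖ ^ (-ρ)) :
    (1 + (‖x‖ + c * T)) * |pt u T x| ≤
      decayConst c ρ * ((1 + 3 * c ^ 2) * M) * jb (c * T - ‖x‖) ^ (2 - ρ) := by
  have hw : ∀ y, ‖y - x‖ ≤ c * T → (snorm 3 φ y + snorm 2 ψ y) * (1 + 3 * c ^ 2) ≤
      (1 + 3 * c ^ 2) * M * jb ‖y‖ ^ (-ρ) := fun y hy => by
    nlinarith [hB y hy, sq_nonneg c]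
  have hle : ∀ {a : ℝ} {y : E3}, ‖y - x‖ ≤ c * T → a ≤ snorm 2 ψ y →
      a ≤ (1 + 3 * c ^ 2) * M * jb ‖y‖ ^ (-ρ) := fun {a y} hy ha => by
    nlinarith [hw y hy, sq_nonneg c, snorm_nonneg 3 φ y, snorm_nonneg 2 ψ y]
  refine h.timeDeriv.abs_le hc hρ hT x (fun y hy => hle hy (abs_le_snorm 2 ψ y))
    (fun j y hy => hle hy (abs_sd_le_snorm (by norm_num) j ψ y)) (fun y hy => ?_)
  have h1 : |∑ j, sd j (sd j φ) y| ≤ 3 * snorm 3 φ y :=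
    calc |∑ j, sd j (sd j φ) y| ≤ ∑ j, |sd j (sd j φ) y| := Finset.abs_sum_le_sum_abs _ _
      _ ≤ ∑ _j : Fin 3, snorm 3 φ y :=
        Finset.sum_le_sum fun j _ => abs_sd_sd_le_snorm (by norm_num) hφ j j y
      _ = 3 * snorm 3 φ y := by simp
  rw [abs_mul, abs_of_nonneg (sq_nonneg c)]
  nlinarith [hw y hy, sq_nonneg c, snorm_nonneg 3 φ y, snorm_nonneg 2 ψ y]

end Cone

/-! ### Weights along the incoming ray -/

lemma inv_mul_jb_rpow_le {κ μ r S l : ℝ} (hκ1 : 1 ≤ κ) (hκ2 : κ ≤ 2) (hμ : 0 < μ)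
    (hr : 1 ≤ r) (hl : l ∈ Set.Icc r S) :
    l⁻¹ * jb (S - 2 * l) ^ (1 - κ - μ) ≤ 5 * jb (S - 2 * r) ^ (1 - κ) *
      (jb (S - 2 * l) ^ (-1 - μ) + jb l ^ (-1 - μ)) := by
  obtain ⟨hrl, hlS⟩ := hl
  have hl1 : 1 ≤ l := hr.trans hrl
  have hl0 : 0 < l := by linarith
  set X := jb (S - 2 * l) with hX
  set Y := jb (S - 2 * r) with hY
  have hX0 : 0 < X := jb_pos _
  have hY0 : 0 < Y := jb_pos _
  have hL0 : 0 < jb l := jb_pos _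
  have hXμ : 0 ≤ X ^ (-1 - μ) := by positivity
  have hLμ : 0 ≤ jb l ^ (-1 - μ) := by positivity
  have hYκ : 0 ≤ Y ^ (1 - κ) := by positivity
  rcases le_total S (4 * l) with h4 | h4
  · have hXl : X ≤ 5 * l := (jb_le (b := S) (by rw [abs_le]; constructor <;> linarith)).trans
      (by linarith)
    have hYl : Y ≤ 5 * l := (jb_le (b := S) (by rw [abs_le]; constructor <;> linarith)).trans
      (by linarith)
    have h1 : X ^ (2 - κ) ≤ (5 * l) ^ (2 - κ) := by
      apply Real.rpow_le_rpow hX0.le hXl; linarith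
    have h2 : (5 * l) ^ (1 - κ) ≤ Y ^ (1 - κ) :=
      Real.rpow_le_rpow_of_nonpos hY0 hYl (by linarith)
    have h3 : X ^ (1 - κ - μ) = X ^ (2 - κ) * X ^ (-1 - μ) := by
      rw [← Real.rpow_add hX0]; congr 1; ring
    have h5 : l⁻¹ * (5 * l) ^ (2 - κ) = 5 * (5 * l) ^ (1 - κ) := by
      rw [show 2 - κ = (1 - κ) + 1 by ring, Real.rpow_add_one (by positivity)]
      field_simp
    calc l⁻¹ * X ^ (1 - κ - μ) = l⁻¹ * X ^ (2 - κ) * X ^ (-1 - μ) := by rw [h3]; ring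
      _ ≤ l⁻¹ * (5 * l) ^ (2 - κ) * X ^ (-1 - μ) := by gcongr
      _ = 5 * (5 * l) ^ (1 - κ) * X ^ (-1 - μ) := by rw [h5]
      _ ≤ 5 * Y ^ (1 - κ) * X ^ (-1 - μ) := by gcongr
      _ ≤ _ := by gcongr; linarith
  · have hYX : Y ≤ 2 * X := by
      have : Y ≤ jb (2 * (S - 2 * l)) :=
        jb_le_of_abs_le (by rw [abs_le]; constructor <;> linarith)
      refine this.trans ?_
      rw [hX, ← sq_le_sq₀ (jb_pos _).le (by positivity), mul_pow, jb_sq, jb_sq]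
      nlinarith
    have hLX : jb l ≤ X := jb_le_of_abs_le (by rw [abs_of_pos hl0]; linarith)
    have hLl : jb l ≤ 2 * l := (jb_le (b := l) (abs_of_pos hl0).le).trans (by linarith)
    have h1 : X ^ (1 - κ) ≤ 2 * Y ^ (1 - κ) := by
      have h2 : X ^ (1 - κ) ≤ (Y / 2) ^ (1 - κ) :=
        Real.rpow_le_rpow_of_nonpos (by positivity) (by linarith) (by linarith)
      rw [Real.div_rpow hY0.le (by norm_num), div_eq_mul_inv, ← Real.rpow_neg (by norm_num)] at h2
      have h3 : (2 : ℝ) ^ (-(1 - κ)) ≤ 2 ^ (1 : ℝ) :=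
        Real.rpow_le_rpow_of_exponent_le (by norm_num) (by linarith)
      rw [Real.rpow_one] at h3
      nlinarith
    have h2 : X ^ (-μ) ≤ jb l ^ (-μ) := Real.rpow_le_rpow_of_nonpos hL0 hLX (by linarith)
    have h3 : l⁻¹ ≤ 2 * (jb l)⁻¹ := by
      rw [← div_eq_mul_inv, inv_eq_one_div, div_le_div_iff₀ hl0 hL0]
      linarith
    have h5 : X ^ (1 - κ - μ) = X ^ (1 - κ) * X ^ (-μ) := by
      rw [← Real.rpow_add hX0]; congr 1
    have h6 : jb l ^ (-1 - μ) = (jb l)⁻¹ * jb l ^ (-μ) := by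
      rw [← Real.rpow_neg_one, ← Real.rpow_add hL0]; congr 1
    calc l⁻¹ * X ^ (1 - κ - μ) = l⁻¹ * (X ^ (1 - κ) * X ^ (-μ)) := by rw [h5]
      _ ≤ 2 * (jb l)⁻¹ * (2 * Y ^ (1 - κ) * jb l ^ (-μ)) := by gcongr
      _ = 4 * Y ^ (1 - κ) * jb l ^ (-1 - μ) := by rw [h6]; ring
      _ ≤ 5 * Y ^ (1 - κ) * jb l ^ (-1 - μ) := by gcongr; norm_num
      _ ≤ _ := by gcongr; linarith

/-! ### The good derivative away from the spatial origin -/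

lemma Smooth.ray_source_eq {u : Fn} (hu : Smooth u) (s : ℝ) {ω : E3} (hω : ‖ω‖ = 1) (l : ℝ) :
    l * (l * (∑ j, pd j (pd j u) s (l • ω) - ∑ i, ∑ j, ω i * ω j * pd i (pd j u) s (l • ω)) -
      2 * ∑ j, ω j * pd j u s (l • ω)) =
    rotA 0 1 (rotA 0 1 u) s (l • ω) + rotA 0 2 (rotA 0 2 u) s (l • ω) +
      rotA 1 2 (rotA 1 2 u) s (l • ω) := by
  have h1 : ∑ i, (l • ω) i ^ 2 = l ^ 2 := by
    rw [← EuclideanSpace.real_norm_sq_eq, norm_smul, hω, mul_one, Real.norm_eq_abs, sq_abs]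
  rw [hu.sum_rotA_sq, h1]
  simp only [PiLp.smul_apply, smul_eq_mul, Fin.sum_univ_three]
  ring

lemma integral_ray_weight_le {μ c S T : ℝ} (hμ : 0 < μ) (hc : 0 < c) (hT : 0 ≤ T) :
    ∫ s in (0 : ℝ)..T, (jb (2 * c * s - S) ^ (-1 - μ) + jb (S - c * s) ^ (-1 - μ)) ≤
      (1 / (2 * c) + 1 / c) * ∫ z, jb z ^ (-1 - μ) := by
  have hcont := continuous_jb_rpow (-1 - μ)
  have h1 : Continuous fun s : ℝ => jb (2 * c * s - S) ^ (-1 - μ) :=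
    hcont.comp (by fun_prop : Continuous fun s : ℝ => 2 * c * s - S)
  have h2 : Continuous fun s : ℝ => jb (S - c * s) ^ (-1 - μ) :=
    hcont.comp (by fun_prop : Continuous fun s : ℝ => S - c * s)
  have hcT : 0 ≤ c * T := mul_nonneg hc.le hT
  rw [intervalIntegral.integral_add (h1.intervalIntegrable _ _) (h2.intervalIntegrable _ _),
    intervalIntegral.integral_comp_mul_sub (fun z => jb z ^ (-1 - μ)) (by positivity),
    intervalIntegral.integral_comp_sub_mul (fun z => jb z ^ (-1 - μ)) hc.ne', add_mul,
    one_div, one_div, smul_eq_mul, smul_eq_mul]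
  refine add_le_add (mul_le_mul_of_nonneg_left (intervalIntegral_jb_rpow_le hμ ?_) (by positivity))
    (mul_le_mul_of_nonneg_left (intervalIntegral_jb_rpow_le hμ ?_) (by positivity)) <;>
  linarith

section Cone

variable {c κ μ M T : ℝ} {φ ψ : SFn} {u : Fn} {ω : E3} {r : ℝ}

lemma cone_mono {l s : ℝ} (hω : ‖ω‖ = 1) (hl : l = r + c * T - c * s) (hsT : c * s ≤ c * T)
    {y : E3} (hy : ‖y - l • ω‖ ≤ c * s) : ‖y - r • ω‖ ≤ c * T := by
  have h1 : ‖l • ω - r • ω‖ = c * T - c * s := by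
    rw [← sub_smul, norm_smul, hω, mul_one, Real.norm_eq_abs, abs_of_nonneg] <;> linarith
  linarith [norm_sub_le_norm_sub_add_norm_sub y (l • ω) (r • ω)]

lemma IsFreeWaveSol.abs_ray_source_le (h : IsFreeWaveSol c φ ψ u) (hc : 0 < c) (hκ1 : 1 ≤ κ)
    (hκ2 : κ ≤ 2) (hμ : 0 < μ) (hω : ‖ω‖ = 1) (hr : 1 ≤ r) (hM : 0 ≤ M)
    (hB : ∀ y, ‖y - r • ω‖ ≤ c * T →
      snorm 3 φ y + snorm 2 ψ y ≤ M * jb ‖y‖ ^ (-(κ + μ + 1)))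
    {s l : ℝ} (hs0 : 0 ≤ s) (hsT : s ≤ T) (hl : l = r + c * T - c * s) :
    |c ^ 2 * (l * (∑ j, pd j (pd j u) s (l • ω) -
        ∑ i, ∑ j, ω i * ω j * pd i (pd j u) s (l • ω)) - 2 * ∑ j, ω j * pd j u s (l • ω))| ≤
      15 * c ^ 2 * decayConst c (κ + μ + 1) * M * jb (c * T - r) ^ (1 - κ) /
        (1 + (r + c * T)) *
        (jb (2 * c * s - (r + c * T)) ^ (-1 - μ) + jb l ^ (-1 - μ)) := by
  have hcs0 : 0 ≤ c * s := mul_nonneg hc.le hs0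
  have hcsT : c * s ≤ c * T := mul_le_mul_of_nonneg_left hsT hc.le
  have hl0 : 0 < l := by linarith
  have hρ : 2 < κ + μ + 1 := by linarith
  have hS : 0 < 1 + (r + c * T) := by linarith
  have hdc := decayConst_pos hc hρ
  set K := decayConst c (κ + μ + 1)
  have hnorm : ‖l • ω‖ = l := by rw [norm_smul, hω, mul_one, Real.norm_eq_abs, abs_of_pos hl0]
  have hrot : ∀ {j k : Fin 3}, j < k → (1 + (r + c * T)) * |rotA j k (rotA j k u) s (l • ω)| ≤
      K * M * jb (r + c * T - 2 * l) ^ (1 - κ - μ) := fun {j k} hjk => by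
    have h1 := h.abs_rotA_rotA_le hc hρ hs0 (fun y hy => hB y (cone_mono hω hl hcsT hy)) hjk
    rwa [hnorm, show l + c * s = r + c * T by rw [hl]; ring,
      show c * s - l = r + c * T - 2 * l by rw [hl]; ring,
      show 2 - (κ + μ + 1) = 1 - κ - μ by ring] at h1
  have hw := inv_mul_jb_rpow_le (S := r + c * T) (l := l) hκ1 hκ2 hμ hr
    ⟨by linarith, by linarith⟩
  have hsrc := h.1.ray_source_eq s hω l
  set D := l * (∑ j, pd j (pd j u) s (l • ω) -
    ∑ i, ∑ j, ω i * ω j * pd i (pd j u) s (l • ω)) - 2 * ∑ j, ω j * pd j u s (l • ω)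
  have h3 : (1 + (r + c * T)) * |l * D| ≤
      3 * (K * M * jb (r + c * T - 2 * l) ^ (1 - κ - μ)) := by
    rw [hsrc]
    have h4 := mul_le_mul_of_nonneg_left (abs_add_three (rotA 0 1 (rotA 0 1 u) s (l • ω))
      (rotA 0 2 (rotA 0 2 u) s (l • ω)) (rotA 1 2 (rotA 1 2 u) s (l • ω))) hS.le
    linarith [hrot (j := 0) (k := 1) (by decide), hrot (j := 0) (k := 2) (by decide),
      hrot (j := 1) (k := 2) (by decide)]
  rw [abs_mul, abs_of_pos hl0] at h3
  rw [abs_mul, abs_of_nonneg (sq_nonneg c), div_mul_eq_mul_div, le_div_iff₀ hS]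
  have e1 : 2 * c * s - (r + c * T) = r + c * T - 2 * l := by rw [hl]; ring
  have e2 : c * T - r = r + c * T - 2 * r := by ring
  rw [e1, e2]
  calc c ^ 2 * |D| * (1 + (r + c * T))
      = c ^ 2 * (l⁻¹ * ((1 + (r + c * T)) * (l * |D|))) := by field_simp
    _ ≤ c ^ 2 * (l⁻¹ * (3 * (K * M * jb (r + c * T - 2 * l) ^ (1 - κ - μ)))) := by gcongr
    _ = 3 * c ^ 2 * K * M * (l⁻¹ * jb (r + c * T - 2 * l) ^ (1 - κ - μ)) := by ring
    _ ≤ 3 * c ^ 2 * K * M * (5 * jb (r + c * T - 2 * r) ^ (1 - κ) *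
        (jb (r + c * T - 2 * l) ^ (-1 - μ) + jb l ^ (-1 - μ))) := by gcongr
    _ = _ := by ring

/-- The constant controlling the good derivative away from the spatial origin. -/
def rayConst (c κ μ : ℝ) : ℝ :=
  15 * c ^ 2 * decayConst c (κ + μ + 1) * ((1 / (2 * c) + 1 / c) * ∫ z, jb z ^ (-1 - μ)) +
    4 * (1 + 4 * c) + c * decayConst c (κ + μ + 1)

lemma rayConst_pos (hc : 0 < c) (hκ : 1 ≤ κ) (hμ : 0 < μ) : 0 < rayConst c κ μ := by
  have h1 := decayConst_pos (c := c) (ρ := κ + μ + 1) hc (by linarith)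
  have h2 : 0 ≤ ∫ z, jb z ^ (-1 - μ) :=
    MeasureTheory.integral_nonneg fun z => Real.rpow_nonneg (jb_pos z).le _
  unfold rayConst
  positivity

lemma IsFreeWaveSol.abs_ray_le (h : IsFreeWaveSol c φ ψ u) (hc : 0 < c) (hκ1 : 1 ≤ κ)
    (hκ2 : κ ≤ 2) (hμ : 0 < μ) (hω : ‖ω‖ = 1) (hr : 1 ≤ r) (hM : 0 ≤ M) (hT : 0 ≤ T)
    (hB : ∀ y, ‖y - r • ω‖ ≤ c * T →
      snorm 3 φ y + snorm 2 ψ y ≤ M * jb ‖y‖ ^ (-(κ + μ + 1))) :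
    (1 + (r + c * T)) * |r * (pt u T (r • ω) + c * ∑ j, ω j * pd j u T (r • ω))| ≤
      rayConst c κ μ * M * jb (c * T - r) ^ (1 - κ) := by
  set S := r + c * T with hSdef
  set Y := jb (c * T - r) with hY
  set K := decayConst c (κ + μ + 1) with hK
  set I := ∫ z, jb z ^ (-1 - μ) with hI
  have hcT : 0 ≤ c * T := mul_nonneg hc.le hT
  have hS1 : 1 ≤ S := by linarith
  have hY1 : 1 ≤ Y := one_le_jb _
  have hρ : 2 < κ + μ + 1 := by linarith
  set F : ℝ → ℝ := fun s => (S - c * s) * pt u s ((0 : E3) + (S - c * s) • ω) +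
    c * u s ((0 : E3) + (S - c * s) • ω) +
    c * (S - c * s) * ∑ j, ω j * pd j u s ((0 : E3) + (S - c * s) • ω) with hF
  set g : ℝ → ℝ := fun s => c ^ 2 * ((S - c * s) * (∑ j, pd j (pd j u) s ((S - c * s) • ω) -
    ∑ i, ∑ j, ω i * ω j * pd i (pd j u) s ((S - c * s) • ω)) -
    2 * ∑ j, ω j * pd j u s ((S - c * s) • ω)) with hg
  have hgc : Continuous g := by
    have hy : Continuous fun s : ℝ => (S - c * s) • ω := by fun_prop
    have h1 := fun j => (h.1.smooth_pd j).continuous_comp continuous_id hy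
    have h2 := fun i j => ((h.1.smooth_pd j).smooth_pd i).continuous_comp continuous_id hy
    simp only [id] at h1 h2
    fun_prop
  have hFTC : ∫ s in (0 : ℝ)..T, g s = F T - F 0 := by
    refine intervalIntegral.integral_eq_sub_of_hasDerivAt (fun s hs => ?_)
      (hgc.intervalIntegrable _ _)
    rw [Set.uIcc_of_le hT] at hs
    have := h.hasDerivAt_ray 0 ω S hs.1
    simpa only [hF, hg, zero_add] using this
  have hint : |F T - F 0| ≤ 15 * c ^ 2 * K * M * Y ^ (1 - κ) / (1 + S) *
      ((1 / (2 * c) + 1 / c) * I) := by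
    have hdc := decayConst_pos hc hρ
    have hYκ : 0 ≤ Y ^ (1 - κ) := Real.rpow_nonneg (jb_pos _).le _
    rw [← hFTC, ← Real.norm_eq_abs]
    have hcont := continuous_jb_rpow (-1 - μ)
    have hc1 : Continuous fun s : ℝ => jb (2 * c * s - S) ^ (-1 - μ) :=
      hcont.comp (by fun_prop : Continuous fun s : ℝ => 2 * c * s - S)
    have hc2 : Continuous fun s : ℝ => jb (S - c * s) ^ (-1 - μ) :=
      hcont.comp (by fun_prop : Continuous fun s : ℝ => S - c * s)
    refine (intervalIntegral.norm_integral_le_of_norm_le hT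
      (g := fun s => 15 * c ^ 2 * K * M * Y ^ (1 - κ) / (1 + S) *
        (jb (2 * c * s - S) ^ (-1 - μ) + jb (S - c * s) ^ (-1 - μ)))
      (Filter.Eventually.of_forall fun s hs => ?_)
      (((hc1.add hc2).const_mul _).intervalIntegrable _ _)).trans ?_
    · exact h.abs_ray_source_le hc hκ1 hκ2 hμ hω hr hM hB hs.1.le hs.2 rfl
    · rw [intervalIntegral.integral_const_mul]
      refine mul_le_mul_of_nonneg_left (integral_ray_weight_le hμ hc hT) ?_
      positivity
  have hF0 : (1 + S) * |F 0| ≤ 4 * (1 + 4 * c) * M * Y ^ (1 - κ) := by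
    have hnorm : ‖S • ω‖ = S := by
      rw [norm_smul, hω, mul_one, Real.norm_eq_abs, abs_of_nonneg (by linarith)]
    have hball : ‖S • ω - r • ω‖ ≤ c * T := by
      rw [← sub_smul, norm_smul, hω, mul_one, Real.norm_eq_abs, abs_of_nonneg] <;> linarith
    have hb := hB _ hball
    rw [hnorm] at hb
    have h0 : F 0 = S * ψ (S • ω) + c * φ (S • ω) + c * S * ∑ j, ω j * sd j φ (S • ω) := by
      simp only [hF, mul_zero, sub_zero, zero_add, h.2.2.1, h.2.2.2, pd_eq_sd h.2.2.1]
    have h1 : |F 0| ≤ (1 + 4 * c) * (1 + S) * (M * jb S ^ (-(κ + μ + 1))) := by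
      rw [h0]
      refine abs_conormal_le hc (by linarith) hω ?_ ?_ fun j => ?_
      · linarith [abs_le_snorm 2 ψ (S • ω), snorm_nonneg 3 φ (S • ω)]
      · linarith [abs_le_snorm 3 φ (S • ω), snorm_nonneg 2 ψ (S • ω)]
      · linarith [abs_sd_le_snorm (s := 3) (by norm_num) j φ (S • ω), snorm_nonneg 2 ψ (S • ω)]
    have hjS := jb_pos S
    have h2 : (1 + S) ^ 2 * jb S ^ (-(κ + μ + 1)) ≤ 4 * Y ^ (1 - κ) :=
      calc (1 + S) ^ 2 * jb S ^ (-(κ + μ + 1))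
          ≤ (2 * jb S) ^ 2 * jb S ^ (-(κ + μ + 1)) := by gcongr; exact one_add_le_jb
        _ = 4 * jb S ^ (1 - κ - μ) := by
          rw [mul_pow, mul_assoc, ← Real.rpow_two (jb S), ← Real.rpow_add hjS]
          congr 1
          · norm_num
          · congr 1
            ring
        _ ≤ 4 * jb S ^ (1 - κ) := by
          gcongr 4 * ?_
          exact Real.rpow_le_rpow_of_exponent_le (one_le_jb S) (by linarith)
        _ ≤ 4 * Y ^ (1 - κ) := by
          gcongr 4 * ?_
          refine Real.rpow_le_rpow_of_nonpos (jb_pos _) (jb_le_of_abs_le ?_) (by linarith)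
          rw [_root_.abs_le]
          constructor <;> linarith
    calc (1 + S) * |F 0| ≤ (1 + S) * ((1 + 4 * c) * (1 + S) * (M * jb S ^ (-(κ + μ + 1)))) := by
          gcongr
      _ = (1 + 4 * c) * M * ((1 + S) ^ 2 * jb S ^ (-(κ + μ + 1))) := by ring
      _ ≤ (1 + 4 * c) * M * (4 * Y ^ (1 - κ)) := by gcongr
      _ = _ := by ring
  have hu : (1 + S) * |c * u T (r • ω)| ≤ c * K * M * Y ^ (1 - κ) := by
    have hnorm : ‖r • ω‖ = r := by
      rw [norm_smul, hω, mul_one, Real.norm_eq_abs, abs_of_nonneg (by linarith)]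
    have h1 := h.abs_le_of_snorm hc hρ hT hB
    rw [hnorm] at h1
    have h2 : Y ^ (2 - (κ + μ + 1)) ≤ Y ^ (1 - κ) :=
      Real.rpow_le_rpow_of_exponent_le hY1 (by linarith)
    have hdc := decayConst_pos hc hρ
    rw [abs_mul, abs_of_pos hc]
    calc (1 + S) * (c * |u T (r • ω)|) = c * ((1 + S) * |u T (r • ω)|) := by ring
      _ ≤ c * (K * M * Y ^ (2 - (κ + μ + 1))) := by gcongr
      _ ≤ c * (K * M * Y ^ (1 - κ)) := by gcongr
      _ = _ := by ring
  have hFT : r * (pt u T (r • ω) + c * ∑ j, ω j * pd j u T (r • ω)) =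
      (F T - F 0) + F 0 + -(c * u T (r • ω)) := by
    simp only [hF, zero_add, hSdef, add_sub_cancel_right]
    ring
  have hint' : (1 + S) * |F T - F 0| ≤
      15 * c ^ 2 * K * M * Y ^ (1 - κ) * ((1 / (2 * c) + 1 / c) * I) := by
    calc _ ≤ (1 + S) * _ := mul_le_mul_of_nonneg_left hint (by linarith)
      _ = _ := by field_simp
  rw [hFT, rayConst]
  have h5 := mul_le_mul_of_nonneg_left (abs_add_three (F T - F 0) (F 0) (-(c * u T (r • ω))))
    (by linarith : 0 ≤ 1 + S)
  rw [abs_neg] at h5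
  linarith

end Cone

/-! ### The good derivative near the spatial origin -/

lemma IsFreeWaveSol.abs_Dp_le {c κ μ M T : ℝ} {φ ψ : SFn} {u : Fn} {x : E3}
    (h : IsFreeWaveSol c φ ψ u) (hφ : ContDiff ℝ (⊤ : ℕ∞) φ) (hc : 0 < c) (hκ1 : 1 ≤ κ)
    (hμ : 0 < μ) (hT : 0 ≤ T) (hM : 0 ≤ M) (hx : x ≠ 0)
    (hB : ∀ y, ‖y - x‖ ≤ c * T →
      snorm 3 φ y + snorm 2 ψ y ≤ M * jb ‖y‖ ^ (-(κ + μ + 1))) :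
    (1 + (‖x‖ + c * T)) * |Dp c u T x| ≤
      (1 + 3 * c + 3 * c ^ 2) * decayConst c (κ + μ + 1) * M * jb (c * T - ‖x‖) ^ (1 - κ) := by
  have hρ : 2 < κ + μ + 1 := by linarith
  have hr : 0 < ‖x‖ := norm_pos_iff.mpr hx
  have hcT : 0 ≤ c * T := mul_nonneg hc.le hT
  have hdc := decayConst_pos hc hρ
  set K := decayConst c (κ + μ + 1)
  have hY : jb (c * T - ‖x‖) ^ (2 - (κ + μ + 1)) ≤ jb (c * T - ‖x‖) ^ (1 - κ) :=
    Real.rpow_le_rpow_of_exponent_le (one_le_jb _) (by linarith)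
  set Y := jb (c * T - ‖x‖)
  set m := M * Y ^ (1 - κ)
  have hm : ∀ a, 0 ≤ a → K * (a * M) * Y ^ (2 - (κ + μ + 1)) ≤ K * a * m := fun a ha => by
    calc K * (a * M) * Y ^ (2 - (κ + μ + 1)) ≤ K * (a * M) * Y ^ (1 - κ) := by gcongr
      _ = _ := by ring
  have hpt := (h.abs_pt_le hφ hc hρ hT hB).trans (hm _ (by positivity))
  have hpd : ∀ j, (1 + (‖x‖ + c * T)) * |pd j u T x| ≤ K * m := fun j => by
    have h1 := hm 1 zero_le_one
    rw [one_mul, mul_one] at h1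
    exact (h.abs_pd_le hφ hc hρ hT hB j).trans h1
  have hpr : |pr u T x| ≤ ∑ j, |pd j u T x| := by
    refine (Finset.abs_sum_le_sum_abs _ _).trans (Finset.sum_le_sum fun j _ => ?_)
    rw [abs_mul, abs_div, abs_of_pos hr]
    exact mul_le_of_le_one_left (abs_nonneg _)
      ((div_le_one hr).mpr (abs_apply_le_norm x j))
  have hDp : |Dp c u T x| ≤ |pt u T x| + c * ∑ j, |pd j u T x| := by
    refine (abs_add_le _ _).trans ?_
    rw [abs_mul, abs_of_pos hc]
    gcongr
  have hsum : (1 + (‖x‖ + c * T)) * ∑ j, |pd j u T x| ≤ 3 * (K * m) := by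
    rw [Finset.mul_sum]
    exact (Finset.sum_le_sum fun j _ => hpd j).trans_eq (by simp)
  calc (1 + (‖x‖ + c * T)) * |Dp c u T x|
      ≤ (1 + (‖x‖ + c * T)) * (|pt u T x| + c * ∑ j, |pd j u T x|) := by gcongr
    _ = (1 + (‖x‖ + c * T)) * |pt u T x| +
        c * ((1 + (‖x‖ + c * T)) * ∑ j, |pd j u T x|) := by ring
    _ ≤ K * (1 + 3 * c ^ 2) * m + c * (3 * (K * m)) := by gcongr
    _ = _ := by ring

lemma IsFreeWaveSol.jb_mul_abs_Dp_le {c κ μ M T : ℝ} {φ ψ : SFn} {u : Fn} {x : E3}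
    (h : IsFreeWaveSol c φ ψ u) (hφ : ContDiff ℝ (⊤ : ℕ∞) φ) (hc : 0 < c) (hκ1 : 1 ≤ κ)
    (hκ2 : κ ≤ 2) (hμ : 0 < μ) (hT : 0 ≤ T) (hM : 0 ≤ M) (hx : x ≠ 0)
    (hB : ∀ y, ‖y - x‖ ≤ c * T →
      snorm 3 φ y + snorm 2 ψ y ≤ M * jb ‖y‖ ^ (-(κ + μ + 1))) :
    jb ‖x‖ * ((1 + (‖x‖ + c * T)) * |Dp c u T x|) ≤
      2 * (rayConst c κ μ + (1 + 3 * c + 3 * c ^ 2) * decayConst c (κ + μ + 1)) * M *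
        jb (c * T - ‖x‖) ^ (1 - κ) := by
  have hdc := decayConst_pos (c := c) (ρ := κ + μ + 1) hc (by linarith)
  have hrc := rayConst_pos hc hκ1 hμ
  have hcT : 0 ≤ c * T := mul_nonneg hc.le hT
  have hr : 0 < ‖x‖ := norm_pos_iff.mpr hx
  have hm : 0 ≤ M * jb (c * T - ‖x‖) ^ (1 - κ) :=
    mul_nonneg hM (Real.rpow_nonneg (jb_pos _).le _)
  have hjb := jb_le (abs_norm x).le
  rcases le_total ‖x‖ 1 with hr1 | hr1
  · calc jb ‖x‖ * ((1 + (‖x‖ + c * T)) * |Dp c u T x|)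
        ≤ 2 * ((1 + 3 * c + 3 * c ^ 2) * decayConst c (κ + μ + 1) * M *
          jb (c * T - ‖x‖) ^ (1 - κ)) :=
          mul_le_mul (by linarith) (h.abs_Dp_le hφ hc hκ1 hμ hT hM hx hB) (by positivity)
            (by norm_num)
      _ ≤ _ := by nlinarith
  · have hω : ‖‖x‖⁻¹ • x‖ = 1 := norm_smul_inv_norm hx
    have hxω : ‖x‖ • ‖x‖⁻¹ • x = x := by rw [smul_smul, mul_inv_cancel₀ hr.ne', one_smul]
    have h1 := h.abs_ray_le (r := ‖x‖) (κ := κ) (μ := μ) hc hκ1 hκ2 hμ hω hr1 hM hT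
      (by rwa [hxω])
    rw [hxω] at h1
    have hDp : pt u T x + c * ∑ j, (‖x‖⁻¹ • x) j * pd j u T x = Dp c u T x := by
      simp only [Dp, pr, PiLp.smul_apply, smul_eq_mul, div_eq_inv_mul]
    rw [hDp, abs_mul, abs_norm] at h1
    calc jb ‖x‖ * ((1 + (‖x‖ + c * T)) * |Dp c u T x|)
        ≤ (2 * ‖x‖) * ((1 + (‖x‖ + c * T)) * |Dp c u T x|) := by
          gcongr
          linarith
      _ = 2 * ((1 + (‖x‖ + c * T)) * (‖x‖ * |Dp c u T x|)) := by ring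
      _ ≤ 2 * (rayConst c κ μ * M * jb (c * T - ‖x‖) ^ (1 - κ)) := by gcongr
      _ ≤ _ := by
        nlinarith [mul_nonneg (by positivity : 0 ≤ (1 + 3 * c + 3 * c ^ 2) *
          decayConst c (κ + μ + 1)) hm]

theorem stmt2 (c : ℝ) (hc : 0 < c) (κ μ : ℝ) (hκ1 : 1 ≤ κ) (hκ2 : κ ≤ 2) (hμ : 0 < μ) :
    ∃ C > (0 : ℝ), ∀ (φ ψ : SFn) (u : Fn), ContDiff ℝ (⊤ : ℕ∞) φ → ContDiff ℝ (⊤ : ℕ∞) ψ →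
      IsFreeWaveSol c φ ψ u →
      ∀ (t : ℝ) (x : E3), 0 < t → x ≠ 0 →
        jb ‖x‖ * jb (t + ‖x‖) * jb (c * t - ‖x‖) ^ (κ - 1) * |Dp c u t x| ≤
          C * Bfun (κ + μ + 1) 2 φ ψ c t x := by
  have hdc := decayConst_pos (c := c) (ρ := κ + μ + 1) hc (by linarith)
  have hrc := rayConst_pos hc hκ1 hμ
  refine ⟨(1 + 1 / c) *
    (2 * (rayConst c κ μ + (1 + 3 * c + 3 * c ^ 2) * decayConst c (κ + μ + 1))),
    by positivity, fun φ ψ u hφ hψ h t x ht hx => ?_⟩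
  set M := Bfun (κ + μ + 1) 2 φ ψ c t x
  have hct : 0 < c * t := mul_pos hc ht
  have hB : ∀ y, ‖y - x‖ ≤ c * t →
      snorm 3 φ y + snorm 2 ψ y ≤ M * jb ‖y‖ ^ (-(κ + μ + 1)) := fun y hy =>
    snorm_add_snorm_le hφ hψ (κ + μ + 1) 2 c t x hy
  have hM : 0 ≤ M := by
    have h1 := (add_nonneg (snorm_nonneg 3 φ x) (snorm_nonneg 2 ψ x)).trans
      (hB x (by simpa using hct.le))
    exact nonneg_of_mul_nonneg_left h1 (Real.rpow_pos_of_pos (jb_pos _) _)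
  have hY := jb_pos (c * t - ‖x‖)
  have hYinv : jb (c * t - ‖x‖) ^ (κ - 1) * jb (c * t - ‖x‖) ^ (1 - κ) = 1 := by
    rw [← Real.rpow_add hY, show κ - 1 + (1 - κ) = 0 by ring, Real.rpow_zero]
  have htr : jb (t + ‖x‖) ≤ (1 + 1 / c) * (1 + (‖x‖ + c * t)) := by
    refine (jb_le (abs_of_nonneg (by positivity)).le).trans ?_
    rw [show (1 + 1 / c) * (1 + (‖x‖ + c * t)) =
      1 + (t + ‖x‖) + (c * t + (1 / c + 1 / c * ‖x‖)) by field_simp; ring]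
    have : 0 ≤ c * t + (1 / c + 1 / c * ‖x‖) := by positivity
    linarith
  have hjx := jb_pos ‖x‖
  have hmain := h.jb_mul_abs_Dp_le hφ hc hκ1 hκ2 hμ ht.le hM hx hB
  calc jb ‖x‖ * jb (t + ‖x‖) * jb (c * t - ‖x‖) ^ (κ - 1) * |Dp c u t x|
      ≤ jb ‖x‖ * ((1 + 1 / c) * (1 + (‖x‖ + c * t))) * jb (c * t - ‖x‖) ^ (κ - 1) *
        |Dp c u t x| := by gcongr
    _ = (1 + 1 / c) * jb (c * t - ‖x‖) ^ (κ - 1) *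
        (jb ‖x‖ * ((1 + (‖x‖ + c * t)) * |Dp c u t x|)) := by ring
    _ ≤ (1 + 1 / c) * jb (c * t - ‖x‖) ^ (κ - 1) *
        (2 * (rayConst c κ μ + (1 + 3 * c + 3 * c ^ 2) * decayConst c (κ + μ + 1)) * M *
          jb (c * t - ‖x‖) ^ (1 - κ)) := by gcongr
    _ = (1 + 1 / c) *
        (2 * (rayConst c κ μ + (1 + 3 * c + 3 * c ^ 2) * decayConst c (κ + μ + 1))) * M *
        (jb (c * t - ‖x‖) ^ (κ - 1) * jb (c * t - ‖x‖) ^ (1 - κ)) := by ring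
    _ = _ := by rw [hYinv, mul_one]

end PaperKatayama
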